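/- arXiv:1201.3734 — 10 statements merged into one kernel-verified Lean document; each statement's English description precedes it below -/
import Mathlib

section
/- Let F be a finite group and let G = (∏_{ℤ} F) ⋊ ℤ be the semidirect product in which n ∈ ℤ acts on f : ℤ → F by (n • f)(k) = f(k − n); endow ∏_{ℤ} F with the product topology (F discrete), ℤ with the discrete topology, and G with the corresponding product topology. Let α = (1, 1) ∈ G be the generator of the ℤ-factor. Then the contraction group U_α = {g ∈ G | αⁿ g α⁻ⁿ → 1} equals the set of elements (f, 0) with f : ℤ → F satisfying: there exists N ∈ ℤ such that f(j) = 1 for all j < N. -/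
/-- The shift action of `ℤ` on `∏_{ℤ} F`: `n` sends `f` to `k ↦ f (k - n)`. -/
def shiftHom (F : Type*) [Group F] : Multiplicative ℤ →* MulAut (∀ _ : ℤ, F) where
  toFun n :=
    { toFun := fun f k => f (k - Multiplicative.toAdd n)
      invFun := fun f k => f (k + Multiplicative.toAdd n)
      left_inv := fun f => by funext k; simp
      right_inv := fun f => by funext k; simp
      map_mul' := fun f g => rfl }
  map_one' := by
    ext f k
    simp
  map_mul' := fun m l => by
    ext f k
    show f (k - Multiplicative.toAdd (m * l)) = f (k - Multiplicative.toAdd m - Multiplicative.toAdd l)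
    congr 1
    simp [sub_sub, add_comm]

/-- The product topology on a semidirect product, induced from the product of the
two factors. -/
instance semidirectProductTopology {N G : Type*} [Group N] [Group G] [TopologicalSpace N]
    [TopologicalSpace G] {φ : G →* MulAut N} : TopologicalSpace (N ⋊[φ] G) :=
  TopologicalSpace.induced (fun x => (x.left, x.right)) inferInstance

theorem lamplighter_conj_eq (F : Type*) [Group F]
    (g : (∀ _ : ℤ, F) ⋊[shiftHom F] Multiplicative ℤ) (n : ℕ) :
    (SemidirectProduct.inr (Multiplicative.ofAdd (1 : ℤ))) ^ n * g *
      ((SemidirectProduct.inr (Multiplicative.ofAdd (1 : ℤ))) ^ n)⁻¹ =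
    (⟨fun k => g.left (k - n), g.right⟩ : (∀ _ : ℤ, F) ⋊[shiftHom F] Multiplicative ℤ) := by
  rw [← map_pow, ← map_inv]
  have h : (Multiplicative.ofAdd (1 : ℤ)) ^ n = Multiplicative.ofAdd (n : ℤ) := by
    rw [← ofAdd_nsmul]; simp
  rw [h]
  apply SemidirectProduct.ext
  · funext k
    rw [SemidirectProduct.mul_left, SemidirectProduct.mul_left, SemidirectProduct.left_inr,
      SemidirectProduct.left_inr, map_one, one_mul, mul_one, SemidirectProduct.right_inr]
    rfl
  · simp [mul_comm]

/-- In the unrestricted lamplighter group `G = (∏_{ℤ} F) ⋊ ℤ` (with `F` a finite discrete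
group), the contraction group of the generator `α = (1,1)` of the `ℤ`-factor consists
exactly of the elements `(f, 0)` where `f` is trivial at all sufficiently negative indices. -/
theorem lamplighter_contraction_group (F : Type*) [Group F] [Finite F] [TopologicalSpace F]
    [DiscreteTopology F] :
    {g : (∀ _ : ℤ, F) ⋊[shiftHom F] Multiplicative ℤ |
        Filter.Tendsto
          (fun n : ℕ =>
            (SemidirectProduct.inr (Multiplicative.ofAdd (1 : ℤ))) ^ n * g *
              ((SemidirectProduct.inr (Multiplicative.ofAdd (1 : ℤ))) ^ n)⁻¹)
          Filter.atTop (nhds 1)} =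
      {g : (∀ _ : ℤ, F) ⋊[shiftHom F] Multiplicative ℤ |
        ∃ f : ∀ _ : ℤ, F, (∃ N : ℤ, ∀ j < N, f j = 1) ∧ g = SemidirectProduct.inl f} := by
  ext g
  simp only [Set.mem_setOf_eq, lamplighter_conj_eq]
  have hind : Topology.IsInducing
      (fun x : (∀ _ : ℤ, F) ⋊[shiftHom F] Multiplicative ℤ => (x.left, x.right)) := ⟨rfl⟩
  rw [hind.tendsto_nhds_iff, nhds_prod_eq, Filter.tendsto_prod_iff']
  simp only [Function.comp_def, SemidirectProduct.one_left, SemidirectProduct.one_right]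
  rw [tendsto_pi_nhds]
  simp only [Pi.one_apply, nhds_discrete, Filter.tendsto_pure, Filter.eventually_const]
  constructor
  · rintro ⟨h1, h2⟩
    refine ⟨g.left, ?_, ?_⟩
    · obtain ⟨M, hM⟩ := Filter.eventually_atTop.1 (h1 0)
      refine ⟨-M, fun j hj => ?_⟩
      have := hM (-j).toNat (by omega)
      have e : (0 : ℤ) - ((-j).toNat : ℤ) = j := by omega
      rwa [e] at this
    · exact SemidirectProduct.ext rfl h2
  · rintro ⟨f, ⟨N, hN⟩, rfl⟩
    refine ⟨fun k => ?_, rfl⟩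
    refine Filter.eventually_atTop.2 ⟨(k - N + 1).toNat, fun n hn => ?_⟩
    exact hN _ (by omega)
end

section
/- Let F be a nontrivial finite group and let G = (∏_{ℤ} F) ⋊ ℤ be the semidirect product in which n ∈ ℤ acts on f : ℤ → F by (n • f)(k) = f(k − n); endow ∏_{ℤ} F with the product topology (F discrete), ℤ with the discrete topology, and G with the corresponding product topology. Let α = (1, 1) ∈ G be the generator of the ℤ-factor, and let U_α = {g ∈ G | αⁿ g α⁻ⁿ → 1} be its contraction group. Then the closure of U_α in G equals (∏_{ℤ} F) × {0} (the canonical copy of ∏_{ℤ} F), and U_α is a proper subset of this closure; in particular U_α is not closed in G. -/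
open Filter Topology in
theorem lamp_tendsto_iff {F : Type*} [Group F] [TopologicalSpace F]
    (u : ℕ → (∀ _ : ℤ, F) ⋊[shiftHom F] Multiplicative ℤ)
    (x : (∀ _ : ℤ, F) ⋊[shiftHom F] Multiplicative ℤ) :
    Tendsto u atTop (𝓝 x) ↔ (∀ k, Tendsto (fun n => (u n).left k) atTop (𝓝 (x.left k))) ∧
      Tendsto (fun n => (u n).right) atTop (𝓝 x.right) := by
  have hi : IsInducing (fun x : (∀ _ : ℤ, F) ⋊[shiftHom F] Multiplicative ℤ =>
    (x.left, x.right)) := ⟨rfl⟩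
  rw [hi.tendsto_nhds_iff, Prod.tendsto_iff, tendsto_pi_nhds]
  rfl

theorem lamp_conj_left {F : Type*} [Group F]
    (g : (∀ _ : ℤ, F) ⋊[shiftHom F] Multiplicative ℤ) (n : ℕ) (k : ℤ) :
    ((SemidirectProduct.inr (Multiplicative.ofAdd (1 : ℤ))) ^ n * g *
      ((SemidirectProduct.inr (Multiplicative.ofAdd (1 : ℤ))) ^ n)⁻¹).left k
      = g.left (k - n) := by
  rw [← map_pow, ← map_inv]
  rw [SemidirectProduct.mul_left, SemidirectProduct.mul_left, SemidirectProduct.left_inr,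
    SemidirectProduct.left_inr, map_one (shiftHom F _), mul_one, one_mul, SemidirectProduct.right_inr]
  change g.left (k - Multiplicative.toAdd (Multiplicative.ofAdd (1 : ℤ) ^ n)) = _
  simp

theorem lamp_conj_right {F : Type*} [Group F]
    (g : (∀ _ : ℤ, F) ⋊[shiftHom F] Multiplicative ℤ) (n : ℕ) :
    ((SemidirectProduct.inr (Multiplicative.ofAdd (1 : ℤ))) ^ n * g *
      ((SemidirectProduct.inr (Multiplicative.ofAdd (1 : ℤ))) ^ n)⁻¹).right
      = g.right := by
  rw [← map_pow, ← map_inv, SemidirectProduct.mul_right, SemidirectProduct.mul_right,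
    SemidirectProduct.right_inr, SemidirectProduct.right_inr, mul_comm, inv_mul_cancel_left]

open Filter Topology in
theorem lamp_mem_iff {F : Type*} [Group F] [TopologicalSpace F] [DiscreteTopology F]
    (g : (∀ _ : ℤ, F) ⋊[shiftHom F] Multiplicative ℤ) :
    Tendsto (fun n : ℕ => (SemidirectProduct.inr (Multiplicative.ofAdd (1 : ℤ))) ^ n * g *
      ((SemidirectProduct.inr (Multiplicative.ofAdd (1 : ℤ))) ^ n)⁻¹) atTop (𝓝 1) ↔
    (∀ k : ℤ, ∀ᶠ n : ℕ in atTop, g.left (k - n) = 1) ∧ g.right = 1 := by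
  rw [lamp_tendsto_iff]
  simp only [lamp_conj_left, lamp_conj_right, nhds_discrete, tendsto_pure, eventually_const,
    SemidirectProduct.one_left, SemidirectProduct.one_right, Pi.one_apply]

/-- In the unrestricted lamplighter group `G = (∏_{ℤ} F) ⋊ ℤ` (with `F` a nontrivial finite
discrete group), the closure of the contraction group `U_α` of the generator `α = (1,1)` of
the `ℤ`-factor is the canonical copy of `∏_{ℤ} F`; moreover `U_α` is a proper subset of its
closure, and in particular `U_α` is not closed. -/
theorem lamplighter_contraction_group_not_closed (F : Type*) [Group F] [Finite F] [Nontrivial F]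
    [TopologicalSpace F] [DiscreteTopology F] :
    closure {g : (∀ _ : ℤ, F) ⋊[shiftHom F] Multiplicative ℤ |
        Filter.Tendsto
          (fun n : ℕ =>
            (SemidirectProduct.inr (Multiplicative.ofAdd (1 : ℤ))) ^ n * g *
              ((SemidirectProduct.inr (Multiplicative.ofAdd (1 : ℤ))) ^ n)⁻¹)
          Filter.atTop (nhds 1)} =
      Set.range (SemidirectProduct.inl :
        (∀ _ : ℤ, F) →* (∀ _ : ℤ, F) ⋊[shiftHom F] Multiplicative ℤ) ∧
    {g : (∀ _ : ℤ, F) ⋊[shiftHom F] Multiplicative ℤ |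
        Filter.Tendsto
          (fun n : ℕ =>
            (SemidirectProduct.inr (Multiplicative.ofAdd (1 : ℤ))) ^ n * g *
              ((SemidirectProduct.inr (Multiplicative.ofAdd (1 : ℤ))) ^ n)⁻¹)
          Filter.atTop (nhds 1)} ⊂
      closure {g : (∀ _ : ℤ, F) ⋊[shiftHom F] Multiplicative ℤ |
        Filter.Tendsto
          (fun n : ℕ =>
            (SemidirectProduct.inr (Multiplicative.ofAdd (1 : ℤ))) ^ n * g *
              ((SemidirectProduct.inr (Multiplicative.ofAdd (1 : ℤ))) ^ n)⁻¹)
          Filter.atTop (nhds 1)} ∧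
    ¬ IsClosed {g : (∀ _ : ℤ, F) ⋊[shiftHom F] Multiplicative ℤ |
        Filter.Tendsto
          (fun n : ℕ =>
            (SemidirectProduct.inr (Multiplicative.ofAdd (1 : ℤ))) ^ n * g *
              ((SemidirectProduct.inr (Multiplicative.ofAdd (1 : ℤ))) ^ n)⁻¹)
          Filter.atTop (nhds 1)} := by
  simp only [lamp_mem_iff]
  set U := {g : (∀ _ : ℤ, F) ⋊[shiftHom F] Multiplicative ℤ |
    (∀ k : ℤ, ∀ᶠ n : ℕ in Filter.atTop, g.left (k - n) = 1) ∧ g.right = 1} with hU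
  have hcl : closure U = Set.range (SemidirectProduct.inl :
        (∀ _ : ℤ, F) →* (∀ _ : ℤ, F) ⋊[shiftHom F] Multiplicative ℤ) := by
    apply Set.Subset.antisymm
    · have hc : Continuous (fun x : (∀ _ : ℤ, F) ⋊[shiftHom F] Multiplicative ℤ => x.right) :=
        continuous_snd.comp (continuous_induced_dom (f := fun
          x : (∀ _ : ℤ, F) ⋊[shiftHom F] Multiplicative ℤ => (x.left, x.right)))
      have hcl : IsClosed {x : (∀ _ : ℤ, F) ⋊[shiftHom F] Multiplicative ℤ | x.right = 1} :=
        isClosed_eq hc continuous_const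
      intro x hx
      have h1 : x.right = 1 := closure_minimal (fun y hy => hy.2) hcl hx
      exact ⟨x.left, by ext <;> simp [h1]⟩
    · rintro _ ⟨f, rfl⟩
      refine mem_closure_of_tendsto (b := Filter.atTop) (f := fun N : ℕ =>
        SemidirectProduct.inl (fun k : ℤ => if -(N : ℤ) ≤ k then f k else 1)) ?_ ?_
      · rw [lamp_tendsto_iff]
        refine ⟨fun k => ?_, by simp⟩
        apply tendsto_const_nhds.congr'
        filter_upwards [Filter.eventually_ge_atTop k.natAbs] with n hn
        have : -(n : ℤ) ≤ k := by omega
        simp [this]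
      · refine Filter.Eventually.of_forall fun N => ⟨fun k => ?_, by simp⟩
        filter_upwards [Filter.eventually_ge_atTop (k.natAbs + N + 1)] with n hn
        have : ¬ (-(N : ℤ) ≤ k - n) := by omega
        simp only [SemidirectProduct.left_inl, if_neg this]
  have hne : ¬ closure U ⊆ U := by
    obtain ⟨a, ha⟩ := exists_ne (1 : F)
    intro h
    have h1 : (SemidirectProduct.inl (fun _ => a) :
        (∀ _ : ℤ, F) ⋊[shiftHom F] Multiplicative ℤ) ∈ U := h (hcl ▸ ⟨_, rfl⟩)
    obtain ⟨n, hn⟩ := (h1.1 0).exists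
    exact ha (by simpa using hn)
  exact ⟨hcl, ⟨subset_closure, hne⟩, fun h => hne h.closure_eq.subset⟩
end

section
/- Let p be a prime, n a natural number, and V = (Fin n → ℚ_p) the n-dimensional vector space over the p-adic numbers with its product topology. Let α : V → V be a ℚ_p-linear map such that for every v ∈ V the sequence (α^k(v))_{k ∈ ℕ} converges to 0. Then the linear map α − id is bijective; in particular, for every v ∈ V the equation α(x) − x = v has a unique solution x ∈ V. -/
/-- Let `V = ℚ_pⁿ` and let `α : V → V` be a `ℚ_p`-linear map such that `α^k(v) → 0` for
every `v`. Then `α - id` is bijective; in particular `α(x) - x = v` has a unique solution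
for every `v`. -/
theorem contracting_padic_linear_map_sub_id_bijective (p : ℕ) [Fact p.Prime] (n : ℕ)
    (α : (Fin n → ℚ_[p]) →ₗ[ℚ_[p]] (Fin n → ℚ_[p]))
    (h : ∀ v : Fin n → ℚ_[p],
      Filter.Tendsto (fun k : ℕ => (α ^ k) v) Filter.atTop (nhds 0)) :
    Function.Bijective ⇑(α - (LinearMap.id : (Fin n → ℚ_[p]) →ₗ[ℚ_[p]] (Fin n → ℚ_[p]))) ∧
      ∀ v : Fin n → ℚ_[p], ∃! x : Fin n → ℚ_[p], α x - x = v := by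
  have hinj : Function.Injective
      ⇑(α - (LinearMap.id : (Fin n → ℚ_[p]) →ₗ[ℚ_[p]] (Fin n → ℚ_[p]))) := by
    rw [injective_iff_map_eq_zero]
    intro x hx
    have hx1 : α x = x := by
      simpa [sub_eq_zero] using hx
    have hk : ∀ k : ℕ, (α ^ k) x = x := by
      intro k
      induction k with
      | zero => simp
      | succ k ih => rw [pow_succ, Module.End.mul_apply, hx1, ih]
    have h1 := h x
    simp only [hk] at h1
    exact tendsto_nhds_unique tendsto_const_nhds h1
  have hbij : Function.Bijective
      ⇑(α - (LinearMap.id : (Fin n → ℚ_[p]) →ₗ[ℚ_[p]] (Fin n → ℚ_[p]))) :=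
    ⟨hinj, LinearMap.injective_iff_surjective.mp hinj⟩
  refine ⟨hbij, fun v => ?_⟩
  simpa using hbij.existsUnique v
end

section
/- Let F be a group and let B be the subgroup of the direct product ∏_{ℤ} F consisting of those f : ℤ → F for which there exists N ∈ ℤ with f(j) = 1 for all j < N. Let σ : B → B be the shift automorphism defined by (σ f)(j) = f(j − 1). Then for every v ∈ B there exists a unique x ∈ B such that (σ x) · x⁻¹ = v; that is, the map B → B, x ↦ (σ x) · x⁻¹, is a bijection. -/
/-- Let `F` be a group and `B ⊆ ∏_{ℤ} F` the subgroup of functions trivial at all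
sufficiently negative indices, with shift automorphism `σ` given by `(σ f)(j) = f (j - 1)`.
Then for every `v ∈ B` there is a unique `x ∈ B` with `(σ x) · x⁻¹ = v`. -/
theorem shift_coboundary_bijective_on_bounded_below (F : Type*) [Group F] :
    ∀ v : ℤ → F, v ∈ {f : ℤ → F | ∃ N : ℤ, ∀ j < N, f j = 1} →
      ∃! x : ℤ → F, x ∈ {f : ℤ → F | ∃ N : ℤ, ∀ j < N, f j = 1} ∧
        (fun j : ℤ => x (j - 1)) * x⁻¹ = v := by
  rintro v ⟨N, hN⟩
  let y : ℕ → F := fun n => Nat.rec 1 (fun n a => (v (N + n))⁻¹ * a) n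
  have y0 : y 0 = 1 := rfl
  have ys : ∀ n : ℕ, y (n + 1) = (v (N + n))⁻¹ * y n := fun n => rfl
  refine ⟨fun j => y (j - N + 1).toNat, ⟨⟨N, fun j hj => ?_⟩, ?_⟩, ?_⟩
  · have h : (j - N + 1).toNat = 0 := by omega
    simp only [h, y0]
  · funext j
    simp only [Pi.mul_apply, Pi.inv_apply]
    rcases lt_or_ge j N with hj | hj
    · have h : (j - N + 1).toNat = 0 := by omega
      have h' : (j - 1 - N + 1).toNat = 0 := by omega
      rw [h, h', y0, hN j hj]
      simp
    · obtain ⟨n, rfl⟩ : ∃ n : ℕ, j = N + n := ⟨(j - N).toNat, by omega⟩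
      have h : (N + (n : ℤ) - N + 1).toNat = n + 1 := by omega
      have h' : (N + (n : ℤ) - 1 - N + 1).toNat = n := by omega
      rw [h, h', ys]
      group
  · rintro x ⟨⟨M, hM⟩, hx⟩
    have hr : ∀ j, x j = (v j)⁻¹ * x (j - 1) := by
      intro j
      rw [← hx]
      simp
    have hlow : ∀ n : ℕ, ∀ j < M + n, j < N → x j = 1 := by
      intro n
      induction n with
      | zero => intro j hj _; exact hM j (by simpa using hj)
      | succ n ih =>
        intro j hj hjN
        rw [hr, hN j hjN, ih (j - 1) (by push_cast at hj; omega) (by omega)]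
        simp
    have hlow' : ∀ j < N, x j = 1 := fun j hj =>
      hlow (N - M).toNat j (by omega) hj
    have hup : ∀ n : ℕ, x (N + n - 1) = y n := by
      intro n
      induction n with
      | zero => rw [y0]; exact hlow' _ (by simp)
      | succ n ih =>
        have e : N + ((n + 1 : ℕ) : ℤ) - 1 = N + n := by push_cast; ring
        rw [e, hr, ih, ys]
    funext j
    rcases lt_or_ge j N with hj | hj
    · have h : (j - N + 1).toNat = 0 := by omega
      simp only [h, y0]
      exact hlow' j hj
    · have h := hup (j - N + 1).toNat
      have e : N + ((j - N + 1).toNat : ℤ) - 1 = j := by omega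
      rw [e] at h
      exact h
end

section
/- Let (X, (U_x)_{x ∈ X}) be a Moufang set, let 0 and ∞ be two distinct elements of X, let G⁺ be the little projective group, let H = {g ∈ G⁺ | g(0) = 0 and g(∞) = ∞} be the Hua subgroup, and let G⁺_∞ = {g ∈ G⁺ | g(∞) = ∞} be the point stabilizer of ∞ in G⁺. If the root group U_∞ is abelian, then H is abelian if and only if G⁺_∞ is metabelian (i.e. the commutator subgroup of G⁺_∞ is abelian). -/
/-- A Moufang set on a set `X`: a family of subgroups `U x` of the symmetric group of `X`
(the root groups) such that each `U x` fixes `x` and acts sharply transitively on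
`X \ {x}`, and such that the family is permuted by conjugation under the little projective
group (the subgroup generated by all root groups). -/
structure MoufangSet (X : Type*) where
  /-- The root groups. -/
  U : X → Subgroup (Equiv.Perm X)
  /-- Each root group fixes its base point. -/
  fixes : ∀ x : X, ∀ u ∈ U x, u x = x
  /-- Each root group acts sharply transitively on the complement of its base point. -/
  sharply_transitive : ∀ x y z : X, y ≠ x → z ≠ x →
    ∃! u : Equiv.Perm X, u ∈ U x ∧ u y = z
  /-- Conjugation by an element `g` of the little projective group carries `U x`
  to `U (g x)`. -/
  conj_eq : ∀ x : X, ∀ g ∈ Subgroup.closure (⋃ y : X, (U y : Set (Equiv.Perm X))),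
    (U x).map (MulAut.conj g).toMonoidHom = U (g x)

/-- The little projective group of a Moufang set: the subgroup of the symmetric group
generated by all the root groups. -/
def MoufangSet.lpg {X : Type*} (M : MoufangSet X) : Subgroup (Equiv.Perm X) :=
  Subgroup.closure (⋃ y : X, (M.U y : Set (Equiv.Perm X)))

namespace MoufangSet

open Equiv

variable {X : Type*} (M : MoufangSet X)

/-- The point stabilizer in the little projective group. -/
def stab (p : X) : Subgroup (Perm X) := M.lpg ⊓ MulAction.stabilizer (Perm X) p

theorem mem_stab {p : X} {g : Perm X} : g ∈ M.stab p ↔ g ∈ M.lpg ∧ g p = p := by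
  simp [stab, Subgroup.mem_inf, MulAction.mem_stabilizer_iff]

theorem U_le_lpg (p : X) : M.U p ≤ M.lpg := fun _ hu =>
  Subgroup.subset_closure (Set.mem_iUnion.2 ⟨p, hu⟩)

theorem U_le_stab (p : X) : M.U p ≤ M.stab p := fun u hu =>
  M.mem_stab.2 ⟨M.U_le_lpg p hu, M.fixes p u hu⟩

theorem eq_of_apply {p y : X} (hy : y ≠ p) {u v : Perm X} (hu : u ∈ M.U p) (hv : v ∈ M.U p)
    (h : u y = v y) : u = v := by
  have hv' : v y ≠ p := fun h' => hy (v.injective (h'.trans (M.fixes p v hv).symm))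
  exact (M.sharply_transitive p y (v y) hy hv').unique ⟨hu, h⟩ ⟨hv, rfl⟩

theorem conj_mem_U {p : X} {g u : Perm X} (hg : g ∈ M.lpg) (hu : u ∈ M.U p) :
    g * u * g⁻¹ ∈ M.U (g p) := by
  rw [← M.conj_eq p g hg]
  exact ⟨u, hu, rfl⟩

theorem conj_mem_U_stab {p : X} {g u : Perm X} (hg : g ∈ M.stab p) (hu : u ∈ M.U p) :
    g * u * g⁻¹ ∈ M.U p := by
  have h := M.mem_stab.1 hg
  have := M.conj_mem_U h.1 hu
  rwa [h.2] at this

theorem conj_mem_comm {p q : X} {g x : Perm X} (hg : g ∈ M.lpg) (hq : g p = q)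
    (hx : x ∈ ⁅M.stab p, M.stab p⁆) : g * x * g⁻¹ ∈ ⁅M.stab q, M.stab q⁆ := by
  have h1 : (M.stab p).map (MulAut.conj g).toMonoidHom ≤ M.stab q := by
    rintro _ ⟨y, hy, rfl⟩
    have hy := M.mem_stab.1 hy
    refine M.mem_stab.2 ⟨M.lpg.mul_mem (M.lpg.mul_mem hg hy.1) (M.lpg.inv_mem hg), ?_⟩
    simp [← hq, hy.2]
  have h2 := Subgroup.commutator_mono h1 h1
  rw [← Subgroup.map_commutator] at h2
  exact h2 ⟨x, hx, rfl⟩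

theorem comm_le_stab (p : X) : ⁅M.stab p, M.stab p⁆ ≤ M.stab p := Subgroup.commutator_le_self _

/-- If `⁅G_i, G_i⁆` is abelian, an element `c` lying in both derived subgroups commutes
with the root group `U i`. -/
theorem key {z i : X} (hzi : z ≠ i)
    (hA : ∀ x ∈ ⁅M.stab i, M.stab i⁆, ∀ y ∈ ⁅M.stab i, M.stab i⁆, x * y = y * x)
    {c : Perm X} (hci : c ∈ ⁅M.stab i, M.stab i⁆) (hcz : c ∈ ⁅M.stab z, M.stab z⁆)
    {a : Perm X} (ha : a ∈ M.U i) : c * a = a * c := by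
  by_cases ha1 : a z = z
  · rw [M.eq_of_apply hzi ha (M.U i).one_mem (by simpa using ha1)]; simp
  obtain ⟨g, ⟨hg, hg'⟩, -⟩ := M.sharply_transitive z (a z) i ha1 hzi.symm
  have ha2 : a⁻¹ z ≠ z := fun h => ha1 (by rw [Perm.inv_eq_iff_eq] at h; exact h.symm)
  obtain ⟨f, ⟨hf, hf'⟩, -⟩ := M.sharply_transitive z i (a⁻¹ z) hzi.symm ha2
  have hcs := M.mem_stab.1 (M.comm_le_stab i hci)
  have hcs' := M.mem_stab.1 (M.comm_le_stab z hcz)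
  obtain ⟨m, hm⟩ : ∃ m, m = g * a * f := ⟨_, rfl⟩
  have hml : m ∈ M.lpg := hm ▸ M.lpg.mul_mem (M.lpg.mul_mem (M.U_le_lpg z hg)
    (M.U_le_lpg i ha)) (M.U_le_lpg z hf)
  have hmz : m z = i := by simp [hm, M.fixes z f hf, hg']
  have hmi : m i = z := by simp [hm, hf', M.fixes z g hg]
  have hmz' : m⁻¹ z = i := by rw [← hmi]; simp
  have hmi' : m⁻¹ i = z := by rw [← hmz]; simp
  have hA0 : ∀ x ∈ ⁅M.stab z, M.stab z⁆, ∀ y ∈ ⁅M.stab z, M.stab z⁆, x * y = y * x := by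
    intro x hx y hy
    have := hA _ (M.conj_mem_comm hml hmz hx) _ (M.conj_mem_comm hml hmz hy)
    have h2 : m * (x * y) * m⁻¹ = m * (y * x) * m⁻¹ := by
      calc _ = m * x * m⁻¹ * (m * y * m⁻¹) := by group
        _ = _ := this
        _ = _ := by group
    exact mul_left_cancel (mul_right_cancel h2)
  obtain ⟨d, hd⟩ : ∃ d, d = m⁻¹ * c * m * c⁻¹ := ⟨_, rfl⟩
  have hdi : d ∈ ⁅M.stab i, M.stab i⁆ := by
    have := M.conj_mem_comm (M.lpg.inv_mem hml) hmz' hcz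
    rw [inv_inv] at this
    exact hd ▸ Subgroup.mul_mem _ this (Subgroup.inv_mem _ hci)
  have hdz : d ∈ ⁅M.stab z, M.stab z⁆ := by
    have := M.conj_mem_comm (M.lpg.inv_mem hml) hmi' hci
    rw [inv_inv] at this
    exact hd ▸ Subgroup.mul_mem _ this (Subgroup.inv_mem _ hcz)
  have hcU : ∀ {u x : Perm X}, x ∈ M.stab z → u ∈ M.U z →
      u * x * u⁻¹ * x⁻¹ ∈ M.U z ∧ u * x * u⁻¹ * x⁻¹ ∈ ⁅M.stab z, M.stab z⁆ := by
    intro u x hx hu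
    refine ⟨?_, Subgroup.commutator_mem_commutator (M.U_le_stab z hu) hx⟩
    have := (M.U z).mul_mem hu (M.conj_mem_U_stab hx ((M.U z).inv_mem hu))
    simpa [mul_assoc] using this
  have hcz' := M.comm_le_stab z hcz
  have hdz' := M.comm_le_stab z hdz
  obtain ⟨s, hs⟩ : ∃ s, s = g⁻¹ * c * g⁻¹⁻¹ * c⁻¹ := ⟨_, rfl⟩
  obtain ⟨r, hr⟩ : ∃ r, r = f * c * f⁻¹ * c⁻¹ := ⟨_, rfl⟩
  obtain ⟨q, hq⟩ : ∃ q, q = f * d⁻¹ * f⁻¹ * d⁻¹⁻¹ := ⟨_, rfl⟩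
  have hsU := hcU hcz' ((M.U z).inv_mem hg)
  have hrU := hcU hcz' hf
  have hqU := hcU ((M.stab z).inv_mem hdz') hf
  rw [← hs] at hsU
  rw [← hr] at hrU
  rw [← hq] at hqU
  obtain ⟨t, ht⟩ : ∃ t, t = q⁻¹ * r := ⟨_, rfl⟩
  have htU : t ∈ M.U z := ht ▸ (M.U z).mul_mem ((M.U z).inv_mem hqU.1) hrU.1
  have htc : t ∈ ⁅M.stab z, M.stab z⁆ :=
    ht ▸ Subgroup.mul_mem _ (Subgroup.inv_mem _ hqU.2) hrU.2
  have hsc := hA0 c hcz s hsU.2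
  have htc := hA0 c hcz t htc
  have hdc := hA c hci d hdi
  obtain ⟨w, hw⟩ : ∃ w, w = a⁻¹ * (c * a * c⁻¹) := ⟨_, rfl⟩
  have hwU : w ∈ M.U i := hw ▸ (M.U i).mul_mem ((M.U i).inv_mem ha)
    (M.conj_mem_U_stab (M.comm_le_stab i hci) ha)
  have main : s * a * w = a * d * t := by
    have e1 : d * t = f * d * c * f⁻¹ * c⁻¹ := by
      rw [ht, hq, hr]; group
    rw [mul_assoc a d t, e1, hs, hw, hd, hm]; group
  have hw1 : c * a * c⁻¹ = a → c * a = a * c := fun h => mul_inv_eq_iff_eq_mul.1 h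
  have ap : ∀ (x y : Perm X) (p : X), (x * y) p = x (y p) := fun _ _ _ => rfl
  have happ : s i = a (d (t i)) := by
    have := congrArg (fun e : Perm X => e i) main
    simpa [ap, M.fixes i w hwU, M.fixes i a ha] using this
  have hF1 : c (s i) = s i := by rw [← ap, hsc, ap, hcs.2]
  have hF2 : c (d (t i)) = d (t i) := by
    rw [← ap, hdc, ap, ← ap c, htc, ap, hcs.2]
  have hdi' := (M.mem_stab.1 (M.comm_le_stab i hdi)).2
  have hdz'' := (M.mem_stab.1 hdz').2
  by_cases hdt : d (t i) = i
  · have hti : t i = i := d.injective (hdt.trans hdi'.symm)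
    have ht1 : t = 1 := M.eq_of_apply hzi.symm htU (M.U z).one_mem (by simpa using hti)
    have hs1 : s = 1 := M.eq_of_apply hzi.symm hsU.1 (M.U z).one_mem (by
      rw [happ, hdt, M.fixes i a ha]; rfl)
    rw [ht1, hs1, one_mul, mul_one] at main
    have hwd : w = d := mul_left_cancel main
    have hw0 : w = 1 := M.eq_of_apply hzi hwU (M.U i).one_mem (by rw [hwd, hdz'']; rfl)
    rw [hw0] at hw
    exact hw1 (inv_mul_eq_one.1 hw.symm).symm
  · apply hw1
    refine M.eq_of_apply hdt (M.conj_mem_U_stab (M.comm_le_stab i hci) ha) ha ?_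
    have : c⁻¹ (d (t i)) = d (t i) := by rw [Perm.inv_eq_iff_eq]; exact hF2.symm
    rw [ap, ap, this, ← happ, hF1]

theorem derived_two (K : Subgroup (Perm X)) :
    derivedSeries ↥K 2 = ⊥ ↔ ∀ x ∈ ⁅K, K⁆, ∀ y ∈ ⁅K, K⁆, x * y = y * x := by
  have h1 : Subgroup.map K.subtype ⁅(⊤ : Subgroup K), (⊤ : Subgroup K)⁆ = ⁅K, K⁆ := by
    rw [Subgroup.map_commutator]; simp [← MonoidHom.range_eq_map]
  have h2 : derivedSeries ↥K 2 =
      ⁅⁅(⊤ : Subgroup K), (⊤ : Subgroup K)⁆, ⁅(⊤ : Subgroup K), (⊤ : Subgroup K)⁆⁆ := rfl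
  rw [h2, ← Subgroup.map_eq_bot_iff_of_injective _ K.subtype_injective,
    Subgroup.map_commutator, h1, Subgroup.commutator_eq_bot_iff_le_centralizer]
  constructor
  · intro h x hx y hy
    exact (Subgroup.mem_centralizer_iff.1 (h hx) y hy).symm
  · intro h x hx
    exact Subgroup.mem_centralizer_iff.2 fun y hy => h y hy x hx

end MoufangSet

/-- In a Moufang set with abelian root group `U ∞`, the Hua subgroup
`H = {g ∈ G⁺ | g 0 = 0, g ∞ = ∞}` is abelian if and only if the point stabilizer
`G⁺_∞` is metabelian. -/
theorem hua_abelian_iff_stabilizer_metabelian {X : Type*} (M : MoufangSet X)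
    (z i : X) (hzi : z ≠ i)
    (hab : ∀ u v : Equiv.Perm X, u ∈ M.U i → v ∈ M.U i → u * v = v * u) :
    (∀ a b : ↥(M.lpg ⊓ MulAction.stabilizer (Equiv.Perm X) z ⊓
        MulAction.stabilizer (Equiv.Perm X) i), a * b = b * a) ↔
      derivedSeries ↥(M.lpg ⊓ MulAction.stabilizer (Equiv.Perm X) i) 2 = ⊥ := by
  have e : M.lpg ⊓ MulAction.stabilizer (Equiv.Perm X) i = M.stab i := rfl
  have hH : ∀ x : Equiv.Perm X, x ∈ M.stab i → x z = z →
      x ∈ M.lpg ⊓ MulAction.stabilizer (Equiv.Perm X) z ⊓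
        MulAction.stabilizer (Equiv.Perm X) i := fun x hx hz =>
    ⟨⟨(M.mem_stab.1 hx).1, hz⟩, (M.mem_stab.1 hx).2⟩
  rw [e, MoufangSet.derived_two]
  constructor
  · intro h
    have hle : ⁅M.stab i, M.stab i⁆ ≤ M.U i := by
      have dec : ∀ x ∈ M.stab i, ∃ u ∈ M.U i, ∃ k ∈ M.stab i, k z = z ∧ x = u * k := by
        intro x hx
        have hxz : x z ≠ i := fun h' =>
          hzi (x.injective (h'.trans (M.mem_stab.1 hx).2.symm))
        obtain ⟨u, ⟨hu, hu'⟩, -⟩ := M.sharply_transitive i z (x z) hzi hxz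
        refine ⟨u, hu, u⁻¹ * x, (M.stab i).mul_mem ((M.stab i).inv_mem (M.U_le_stab i hu)) hx,
          ?_, by group⟩
        rw [Equiv.Perm.mul_apply, ← hu']; simp
      rw [Subgroup.commutator_le]
      intro x hx y hy
      obtain ⟨u, hu, k, hk, hkz, rfl⟩ := dec x hx
      obtain ⟨v, hv, l, hl, hlz, rfl⟩ := dec y hy
      have hkl : k * l = l * k := congrArg Subtype.val
        (h ⟨k, hH k hk hkz⟩ ⟨l, hH l hl hlz⟩)
      have : u * k * (v * l) * (u * k)⁻¹ * (v * l)⁻¹ = u * (k * v * k⁻¹) * (l * u⁻¹ * l⁻¹) * v⁻¹ := by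
        have h3 : k * l * k⁻¹ = l := by rw [hkl]; group
        calc u * k * (v * l) * (u * k)⁻¹ * (v * l)⁻¹ = u * (k * v * k⁻¹) * ((k * l * k⁻¹) * u⁻¹ * l⁻¹) * v⁻¹ := by
              group
          _ = _ := by rw [h3]
      rw [commutatorElement_def, this]
      exact (M.U i).mul_mem ((M.U i).mul_mem ((M.U i).mul_mem hu (M.conj_mem_U_stab hk hv))
        (M.conj_mem_U_stab hl ((M.U i).inv_mem hu))) ((M.U i).inv_mem hv)
    exact fun x hx y hy => hab x y (hle hx) (hle hy)
  · rintro hA ⟨a, ⟨ha1, ha2⟩, ha3⟩ ⟨b, ⟨hb1, hb2⟩, hb3⟩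
    apply Subtype.ext
    change a * b = b * a
    have hai : a ∈ M.stab i := ⟨ha1, ha3⟩
    have haz : a ∈ M.stab z := ⟨ha1, ha2⟩
    have hbi : b ∈ M.stab i := ⟨hb1, hb3⟩
    have hbz : b ∈ M.stab z := ⟨hb1, hb2⟩
    have hci := Subgroup.commutator_mem_commutator hai hbi
    have hcz := Subgroup.commutator_mem_commutator haz hbz
    rw [← commutatorElement_eq_one_iff_mul_comm]
    ext p
    by_cases hp : p = i
    · rw [hp]; exact (M.mem_stab.1 (M.comm_le_stab i hci)).2
    · obtain ⟨u, ⟨hu, rfl⟩, -⟩ := M.sharply_transitive i z p hzi hp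
      have := congrArg (fun e : Equiv.Perm X => e z) (M.key hzi hA hci hcz hu)
      simp only [Equiv.Perm.mul_apply] at this
      rw [Equiv.Perm.one_apply]
      rw [this, (M.mem_stab.1 (M.comm_le_stab z hcz)).2]
end

section
/- Let (X, (U_x)_{x ∈ X}) be a Moufang set with little projective group G⁺. Suppose that every root group U_x is solvable and that G⁺ is perfect, i.e. G⁺ equals its own commutator subgroup. Then G⁺ is simple as an abstract group: every normal subgroup of G⁺ is either trivial or all of G⁺. -/
/-- If the root groups of a Moufang set are solvable and the little projective group `G⁺`
is perfect, then `G⁺` is simple as an abstract group. -/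
theorem lpg_simple_of_solvable_root_groups_of_perfect {X : Type*} (M : MoufangSet X)
    (hsolv : ∀ x : X, IsSolvable ↥(M.U x))
    (hperf : commutator ↥M.lpg = ⊤) :
    ∀ N : Subgroup ↥M.lpg, N.Normal → N = ⊥ ∨ N = ⊤ := by
  classical
  intro N hN
  by_cases hbot : N = ⊥
  · exact Or.inl hbot
  right
  have hUle : ∀ x, M.U x ≤ M.lpg := fun x u hu =>
    Subgroup.subset_closure (Set.mem_iUnion.2 ⟨x, hu⟩)
  obtain ⟨n, hnN, hn1⟩ := N.bot_or_exists_ne_one.resolve_left hbot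
  obtain ⟨a, ha⟩ : ∃ a, n.1 a ≠ a := by
    by_contra hcon
    push Not at hcon
    exact hn1 (Subtype.ext (Equiv.ext hcon))
  have htrans : ∀ z, ∃ m ∈ N, m.1 a = z := by
    intro z
    by_cases hz : z = a
    · exact ⟨1, N.one_mem, by simp [hz]⟩
    obtain ⟨u, ⟨hu, huz⟩, -⟩ := M.sharply_transitive a (n.1 a) z ha hz
    refine ⟨⟨u, hUle a hu⟩ * n * (⟨u, hUle a hu⟩)⁻¹, hN.conj_mem n hnN _, ?_⟩
    have : u⁻¹ a = a := M.fixes a _ ((M.U a).inv_mem hu)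
    change u (n.1 (u⁻¹ a)) = z
    rw [this, huz]
  let f : M.U a →* M.lpg ⧸ N := (QuotientGroup.mk' N).comp (Subgroup.inclusion (hUle a))
  have hsurj : Function.Surjective f := by
    have hle : M.lpg ≤ (f.range.comap (QuotientGroup.mk' N)).map M.lpg.subtype := by
      refine (Subgroup.closure_le _).2 ?_
      intro u hu
      obtain ⟨y, hy⟩ := Set.mem_iUnion.1 hu
      obtain ⟨m, hm, rfl⟩ := htrans y
      have hy' : u ∈ M.U (m.1 a) := hy
      rw [← M.conj_eq a m.1 m.2] at hy'
      obtain ⟨v, hv, rfl⟩ := hy'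
      refine ⟨m * ⟨v, hUle a hv⟩ * m⁻¹, ⟨⟨v, hv⟩, ?_⟩, rfl⟩
      have h1 : QuotientGroup.mk' N m = 1 := (QuotientGroup.eq_one_iff m).2 hm
      rw [map_mul, map_mul, map_inv, h1]
      simp [f, Subgroup.inclusion]
    intro q
    obtain ⟨g, rfl⟩ := QuotientGroup.mk'_surjective N q
    obtain ⟨g', hg', hgg⟩ := hle g.2
    have : g' = g := Subtype.ext hgg
    subst this
    exact hg'
  have hsa : Group.IsSolvable (M.U a) := hsolv a
  have hs : Group.IsSolvable (M.lpg ⧸ N) := Group.isSolvable_of_surjective hsurj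
  have hp : commutator (M.lpg ⧸ N) = ⊤ := by
    have h := congrArg (Subgroup.map (QuotientGroup.mk' N)) hperf
    rw [commutator_def, Subgroup.map_commutator,
      Subgroup.map_top_of_surjective _ (QuotientGroup.mk'_surjective N)] at h
    rw [commutator_def, h]
  have hsub : Subsingleton (M.lpg ⧸ N) := by
    by_contra hnt
    rw [not_subsingleton_iff_nontrivial] at hnt
    exact (Group.IsSolvable.commutator_lt_top_of_nontrivial (M.lpg ⧸ N)).ne hp
  exact QuotientGroup.subsingleton_iff.1 hsub
end

section
/- Let X be a set and let G be a subgroup of the symmetric group of X which is 3-transitive: for all pairwise distinct x₁, x₂, x₃ ∈ X and all pairwise distinct y₁, y₂, y₃ ∈ X there exists g ∈ G with g(xᵢ) = yᵢ for i = 1, 2, 3. Suppose that for every x ∈ X the point stabilizer G_x = {g ∈ G | g(x) = x} is metabelian (its commutator subgroup is abelian). Then G is sharply 3-transitive: for all pairwise distinct x₁, x₂, x₃ ∈ X and all pairwise distinct y₁, y₂, y₃ ∈ X there exists a unique g ∈ G with g(xᵢ) = yᵢ for i = 1, 2, 3. -/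
open scoped commutatorElement in
theorem aux_fix_three {X : Type*}
    (G : Subgroup (Equiv.Perm X))
    (h3 : ∀ x₁ x₂ x₃ y₁ y₂ y₃ : X,
      x₁ ≠ x₂ → x₁ ≠ x₃ → x₂ ≠ x₃ → y₁ ≠ y₂ → y₁ ≠ y₃ → y₂ ≠ y₃ →
      ∃ g ∈ G, g x₁ = y₁ ∧ g x₂ = y₂ ∧ g x₃ = y₃)
    (x x₂ x₃ : X) (h12 : x ≠ x₂) (h13 : x ≠ x₃) (h23 : x₂ ≠ x₃)
    (H : Subgroup (Equiv.Perm X)) (hH : ∀ g, g ∈ H ↔ g ∈ G ∧ g x = x)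
    (hmet : derivedSeries H 2 = ⊥)
    (g : Equiv.Perm X) (hg : g ∈ H) (hg2 : g x₂ = x₂) (hg3 : g x₃ = x₃) : g = 1 := by
  have hD : ∀ a ∈ derivedSeries H 1, ∀ b ∈ derivedSeries H 1, a * b = b * a := by
    intro a ha b hb
    have h : ⁅a, b⁆ ∈ derivedSeries H 2 := by
      rw [derivedSeries_succ]
      exact Subgroup.commutator_mem_commutator ha hb
    rw [hmet, Subgroup.mem_bot] at h
    exact commutatorElement_eq_one_iff_mul_comm.mp h
  have hcomm : ∀ a b : H, ⁅a, b⁆ ∈ derivedSeries H 1 := by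
    intro a b
    rw [derivedSeries_succ]
    exact Subgroup.commutator_mem_commutator (by simp) (by simp)
  -- commutators fixing `x₂` are trivial
  have key : ∀ a ∈ derivedSeries H 1, a.1 x₂ = x₂ → a = 1 := by
    intro a ha ha2
    by_contra hne
    have hmv : ∃ y, a.1 y ≠ y := by
      by_contra! hall
      exact hne (Subtype.ext (Equiv.ext hall))
    obtain ⟨y, hy⟩ := hmv
    have hax : a.1 x = x := ((hH _).1 a.2).2
    have hyx : x ≠ y := by
      rintro rfl
      exact hy hax
    have hzx : x ≠ a.1 y := by
      intro h
      exact hyx (a.1.injective (hax.trans h))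
    have hy2 : x₂ ≠ y := by
      rintro rfl
      exact hy ha2
    obtain ⟨h, hhG, h1, h2, h4⟩ := h3 x y (a.1 y) x x₂ y hyx hzx (Ne.symm hy) h12 hyx hy2
    let k : H := ⟨h, (hH h).2 ⟨hhG, h1⟩⟩
    have hd : k * a * k⁻¹ ∈ derivedSeries H 1 :=
      (derivedSeries_normal H 1).conj_mem a ha k
    have hdv : (k * a * k⁻¹).1 x₂ = y := by
      change h (a.1 (h⁻¹ x₂)) = y
      rw [← h2]
      simpa using h4
    have hc := hD _ ha _ hd
    have hc' := congrArg (fun t : H => t.1 x₂) hc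
    change a.1 ((k * a * k⁻¹).1 x₂) = (k * a * k⁻¹).1 (a.1 x₂) at hc'
    rw [ha2, hdv] at hc'
    exact hy hc'
  ext p
  change g p = p
  by_cases hp1 : x = p
  · rw [← hp1]
    exact ((hH _).1 hg).2
  by_cases hp2 : x₂ = p
  · rw [← hp2]
    exact hg2
  obtain ⟨k, hkG, k1, k2, k3⟩ := h3 x x₂ x₃ x x₂ p h12 h13 h23 h12 hp1 hp2
  let g' : H := ⟨g, hg⟩
  let k' : H := ⟨k, (hH k).2 ⟨hkG, k1⟩⟩
  have h1 : ⁅g', k'⁆ = 1 := by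
    apply key _ (hcomm _ _)
    change g (k (g⁻¹ (k⁻¹ x₂))) = x₂
    have e1 : k⁻¹ x₂ = x₂ := by
      rw [Equiv.Perm.inv_eq_iff_eq, k2]
    have e2 : g⁻¹ x₂ = x₂ := by
      rw [Equiv.Perm.inv_eq_iff_eq, hg2]
    rw [e1, e2, k2, hg2]
  have h2 := congrArg (fun t : H => t.1 x₃) (commutatorElement_eq_one_iff_mul_comm.mp h1)
  change g (k x₃) = k (g x₃) at h2
  rwa [hg3, k3] at h2

/-- A 3-transitive permutation group whose point stabilizers are metabelian is sharply
3-transitive. -/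
theorem sharply_three_transitive_of_metabelian_stabilizers {X : Type*}
    (G : Subgroup (Equiv.Perm X))
    (h3 : ∀ x₁ x₂ x₃ y₁ y₂ y₃ : X,
      x₁ ≠ x₂ → x₁ ≠ x₃ → x₂ ≠ x₃ → y₁ ≠ y₂ → y₁ ≠ y₃ → y₂ ≠ y₃ →
      ∃ g ∈ G, g x₁ = y₁ ∧ g x₂ = y₂ ∧ g x₃ = y₃)
    (hmet : ∀ x : X,
      derivedSeries ↥(G ⊓ MulAction.stabilizer (Equiv.Perm X) x) 2 = ⊥) :
    ∀ x₁ x₂ x₃ y₁ y₂ y₃ : X,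
      x₁ ≠ x₂ → x₁ ≠ x₃ → x₂ ≠ x₃ → y₁ ≠ y₂ → y₁ ≠ y₃ → y₂ ≠ y₃ →
      ∃! g : Equiv.Perm X, g ∈ G ∧ g x₁ = y₁ ∧ g x₂ = y₂ ∧ g x₃ = y₃ := by
  intro x₁ x₂ x₃ y₁ y₂ y₃ h12 h13 h23 k12 k13 k23
  obtain ⟨g, hg, g1, g2, g3⟩ := h3 x₁ x₂ x₃ y₁ y₂ y₃ h12 h13 h23 k12 k13 k23
  refine ⟨g, ⟨hg, g1, g2, g3⟩, ?_⟩
  rintro f ⟨hf, f1, f2, f3⟩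
  have h : g⁻¹ * f = 1 := by
    refine aux_fix_three G h3 x₁ x₂ x₃ h12 h13 h23
      (G ⊓ MulAction.stabilizer (Equiv.Perm X) x₁) ?_ (hmet x₁) _ ⟨?_, ?_⟩ ?_ ?_
    · intro g
      rw [Subgroup.mem_inf, MulAction.mem_stabilizer_iff, Equiv.Perm.smul_def]
    · exact G.mul_mem (G.inv_mem hg) hf
    · change g⁻¹ (f x₁) = x₁
      rw [Equiv.Perm.inv_eq_iff_eq, f1, g1]
    · change g⁻¹ (f x₂) = x₂
      rw [Equiv.Perm.inv_eq_iff_eq, f2, g2]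
    · change g⁻¹ (f x₃) = x₃
      rw [Equiv.Perm.inv_eq_iff_eq, f3, g3]
  exact (inv_mul_eq_one.mp h).symm
end

section
/- Let X be a set containing at least three pairwise distinct elements and let G be a subgroup of the symmetric group of X which is 3-transitive: for all pairwise distinct x₁, x₂, x₃ ∈ X and all pairwise distinct y₁, y₂, y₃ ∈ X there exists g ∈ G with g(xᵢ) = yᵢ for i = 1, 2, 3. Suppose that for every x ∈ X the point stabilizer G_x = {g ∈ G | g(x) = x} is metabelian. Then there exist a field k and a bijection e : X → ℙ(k²) (the projectivization of the 2-dimensional vector space k² = Fin 2 → k) such that a permutation g of X belongs to G if and only if there exists a k-linear automorphism T of k² with e(g(x)) = [T](e(x)) for all x ∈ X, where [T] denotes the map induced by T on the projectivization. In other words, G is the group PGL₂(k) acting on the projective line over k. -/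
theorem sigma_inv {K : Type*} [Field K] (s : K → K) (h1 : s 1 = 1)
    (hmul : ∀ x y, x ≠ 0 → y ≠ 0 → s (x * y) = s x * s y) (h0 : ∀ x, x ≠ 0 → s x ≠ 0)
    (hss : ∀ x, x ≠ 0 → s (s x) = x)
    (hf : ∀ x, x ≠ 0 → x ≠ 1 → s (1 - s x) = 1 - s (1 - x)) :
    ∀ x, x ≠ 0 → s x = x⁻¹ := by
  have hfix : ∀ c, c ≠ 0 → c ≠ 1 → s c = c → (2:K) * s (1 - c) = 1 := by
    intro c hc hc1 h
    have := hf c hc hc1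
    rw [h] at this
    linear_combination this
  have hfs : ∀ x, x ≠ 0 → s (x * s x) = x * s x := by
    intro x hx
    rw [hmul _ _ hx (h0 x hx), hss x hx, mul_comm]
  have hx0 : ∀ x, x ≠ 0 → x * s x ≠ 0 := fun x hx => mul_ne_zero hx (h0 x hx)
  suffices H : ∀ x, x ≠ 0 → x * s x = 1 by
    intro x hx
    exact eq_inv_of_mul_eq_one_right (H x hx)
  by_cases h2 : (2:K) = 0
  · intro x hx
    by_contra hne
    have := hfix _ (hx0 x hx) hne (hfs x hx)
    simp [h2] at this
  have hm1 : (-1:K) ≠ 1 := by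
    intro h; apply h2; linear_combination -h
  have hn0 : (-1:K) ≠ 0 := by simp
  have hsm1 : s (-1) = -1 := by
    have h := hmul (-1) (-1) hn0 hn0
    rw [neg_one_mul, neg_neg, h1] at h
    rcases mul_self_eq_one_iff.1 h.symm with h | h
    · have := hss (-1) hn0
      rw [h, h1] at this
      exact absurd this.symm hm1
    · exact h
  -- every fixed point is `1` or `-1`
  have huniq : ∀ c, c ≠ 0 → s c = c → c = 1 ∨ c = -1 := by
    intro c hc h
    by_cases hc1 : c = 1
    · exact Or.inl hc1
    right
    have e1 := hfix c hc hc1 h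
    have e2 := hfix (-1) hn0 hm1 hsm1
    have e3 : s (1 - c) = s (1 - -1) := mul_left_cancel₀ h2 (e1.trans e2.symm)
    have e4 : 1 - c ≠ 0 := sub_ne_zero.2 (Ne.symm hc1)
    have e5 : (1 - -1 : K) ≠ 0 := sub_ne_zero.2 (Ne.symm hm1)
    have e6 := congrArg s e3
    rw [hss _ e4, hss _ e5] at e6
    linear_combination -e6
  have hpm : ∀ x, x ≠ 0 → x * s x = 1 ∨ x * s x = -1 := fun x hx =>
    huniq _ (hx0 x hx) (hfs x hx)
  have key : ∀ x, x ≠ 0 → x * s x = -1 → x * x = x + 1 := by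
    intro x hx h
    have hx1 : x ≠ 1 := by
      rintro rfl
      rw [h1] at h
      apply hm1; rw [← h]; ring
    have hxm : x ≠ -1 := by
      rintro rfl
      rw [hsm1] at h
      apply hm1; rw [← h]; ring
    have a1 : 1 + x ≠ 0 := by
      intro h'; apply hxm; linear_combination h'
    have a2 : 1 - x ≠ 0 := sub_ne_zero.2 (Ne.symm hx1)
    have a3 : 1 - s x ≠ 0 := by
      intro h'
      apply hxm
      have : s x = 1 := by linear_combination -h'
      rw [this] at h; simpa using h
    have hm := hmul x (1 - s x) hx a3
    have hxe : x * (1 - s x) = 1 + x := by linear_combination -h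
    rw [hxe, hf x hx hx1] at hm
    -- s (1+x) = s x * (1 - s (1-x))
    have b : (1 - x) * (x * s (1 + x)) = - (1 - x - (1-x) * s (1 - x)) := by
      rw [hm]; linear_combination (1-x) * (1 - s (1-x)) * h
    rcases hpm _ a1 with e | e <;> rcases hpm _ a2 with d | d <;> rw [d] at b
    · exfalso
      have : 2 * (x * x) = 0 := by linear_combination (-(1+x)) * b + (1-x)*x*e
      simp_all
    · have : 2 * (x * x - (x + 1)) = 0 := by linear_combination (-(1+x)) * b + (1-x)*x*e
      have := (mul_eq_zero.1 this).resolve_left h2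
      linear_combination this
    · exfalso
      have : 2 * x = 0 := by linear_combination (-(1+x)) * b + (1-x)*x*e
      simp_all
    · exfalso
      have : (2:K) = 0 := by linear_combination (1+x) * b - (1-x)*x*e
      exact h2 this
  intro x hx
  refine (hpm x hx).resolve_right fun h => ?_
  have k1 := key x hx h
  have k2 := key (-x) (neg_ne_zero.2 hx) (by
    have := hmul (-1) x hn0 hx
    rw [neg_one_mul, hsm1] at this
    rw [this]; linear_combination h)
  have : 2 * x = 0 := by linear_combination k2 - k1
  exact (mul_ne_zero h2 hx) this

open OnePoint in
/-- a permutation group on the projective line that contains all affine maps, is sharp on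
`∞, 0, 1` and contains the inversion is determined -/
theorem le_of_gens {K : Type*} [Field K] [DecidableEq K] (H R : Subgroup (Equiv.Perm (OnePoint K)))
    (hs : ∀ g ∈ H, g ∞ = ∞ → g ((0:K) : OnePoint K) = ((0:K) : OnePoint K) →
      g ((1:K) : OnePoint K) = ((1:K) : OnePoint K) → g = 1)
    (ht : ∀ a : K, ∃ g ∈ H ⊓ R, g ∞ = ∞ ∧ ∀ x : K, g (x : OnePoint K) = ((a + x : K) : OnePoint K))
    (hm : ∀ a : K, a ≠ 0 → ∃ g ∈ H ⊓ R, g ∞ = ∞ ∧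
      ∀ x : K, g (x : OnePoint K) = ((a * x : K) : OnePoint K))
    (hw : ∃ g ∈ H ⊓ R, g ((0:K) : OnePoint K) = ∞) : H ≤ R := by
  have step : ∀ r ∈ H ⊓ R, ∀ g ∈ H, (r * g ∈ H → r * g ∈ R) → g ∈ R := by
    intro r hr g hg h
    have := h (H.mul_mem hr.1 hg)
    exact (R.mul_mem_cancel_left hr.2).1 this
  have c1 : ∀ g ∈ H, g ∞ = ∞ → g ((0:K) : OnePoint K) = ((0:K) : OnePoint K) → g ∈ R := by
    intro g hg h1 h0
    have hne : g ((1:K) : OnePoint K) ≠ ∞ := fun h => by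
      have := g.injective (h.trans h1.symm); simp at this
    obtain ⟨a, ha⟩ := OnePoint.ne_infty_iff_exists.1 hne
    have ha0 : a ≠ 0 := by
      rintro rfl
      have := g.injective (ha.symm.trans h0.symm); simp at this
    obtain ⟨m, hmm, hm1, hm2⟩ := hm a⁻¹ (inv_ne_zero ha0)
    refine step m hmm g hg fun hgg => ?_
    rw [hs _ hgg (by simp [h1, hm1]) (by simp [h0, hm2]) (by simp [← ha, hm2, ha0])]
    exact R.one_mem
  have c2 : ∀ g ∈ H, g ∞ = ∞ → g ∈ R := by
    intro g hg h1
    have hne : g ((0:K) : OnePoint K) ≠ ∞ := fun h => by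
      have := g.injective (h.trans h1.symm); simp at this
    obtain ⟨a, ha⟩ := OnePoint.ne_infty_iff_exists.1 hne
    obtain ⟨m, hmm, hm1, hm2⟩ := ht (-a)
    refine step m hmm g hg fun hgg => ?_
    exact c1 _ hgg (by simp [h1, hm1]) (by simp [← ha, hm2])
  intro g hg
  by_cases h : g ∞ = ∞
  · exact c2 g hg h
  obtain ⟨a, ha⟩ := OnePoint.ne_infty_iff_exists.1 h
  obtain ⟨m, hmm, hm1, hm2⟩ := ht (-a)
  obtain ⟨w, hww, hw1⟩ := hw
  refine step m hmm g hg fun hgg => ?_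
  refine step w hww _ hgg fun hgg' => ?_
  exact c2 _ hgg' (by simp [← ha, hm2, hw1])

open OnePoint in
theorem eq_range_GL {K : Type*} [Field K] [DecidableEq K] (G : Subgroup (Equiv.Perm (OnePoint K)))
    (hs : ∀ g ∈ G, g ∞ = ∞ → g ((0:K) : OnePoint K) = ((0:K) : OnePoint K) →
      g ((1:K) : OnePoint K) = ((1:K) : OnePoint K) → g = 1)
    (ht : ∀ a : K, ∃ g ∈ G, g ∞ = ∞ ∧ ∀ x : K, g (x : OnePoint K) = ((a + x : K) : OnePoint K))
    (hm : ∀ a : K, a ≠ 0 → ∃ g ∈ G, g ∞ = ∞ ∧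
      ∀ x : K, g (x : OnePoint K) = ((a * x : K) : OnePoint K))
    (hw : ∃ g ∈ G, g ((0:K) : OnePoint K) = ∞ ∧ g ∞ = ((0:K) : OnePoint K) ∧
      g ((1:K) : OnePoint K) = ((1:K) : OnePoint K)) :
    G = (MulAction.toPermHom (Matrix.GeneralLinearGroup (Fin 2) K) (OnePoint K)).range := by
  have sharp : ∀ g ∈ G, ∀ h ∈ G, g ∞ = h ∞ →
      g ((0:K) : OnePoint K) = h ((0:K) : OnePoint K) →
      g ((1:K) : OnePoint K) = h ((1:K) : OnePoint K) → g = h := by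
    intro g hg h hh e1 e2 e3
    have := hs (h⁻¹ * g) (G.mul_mem (G.inv_mem hh) hg) (by simp [e1]) (by simp [e2]) (by simp [e3])
    exact (inv_mul_eq_one.1 this).symm
  obtain ⟨w, hwG, w0, wi, w1⟩ := hw
  have hww : ∀ x, w (w x) = x := by
    have : w * w = 1 := hs _ (G.mul_mem hwG hwG) (by simp [w0, wi]) (by simp [w0, wi]) (by simp [w1])
    intro x
    rw [← Equiv.Perm.mul_apply, this]; rfl
  have hex : ∀ x : K, ∃ y : K, x ≠ 0 → w (x : OnePoint K) = (y : OnePoint K) := by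
    intro x
    by_cases hx : x = 0
    · exact ⟨0, fun h => absurd hx h⟩
    have hne : w (x : OnePoint K) ≠ ∞ := fun h => by
      have := w.injective (h.trans w0.symm)
      exact hx (by simpa using this)
    obtain ⟨a, ha⟩ := OnePoint.ne_infty_iff_exists.1 hne
    exact ⟨a, fun _ => ha.symm⟩
  choose s hsw using hex
  have s0 : ∀ x, x ≠ 0 → s x ≠ 0 := by
    intro x hx h
    have := hsw x hx
    rw [h, ← wi] at this
    simpa using w.injective this
  have hinv : ∀ x, x ≠ 0 → s x = x⁻¹ := by
    apply sigma_inv s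
    · have := hsw 1 one_ne_zero
      rw [w1] at this
      exact (OnePoint.coe_injective this).symm
    · intro x y hx hy
      obtain ⟨m, hmG, mi, mx⟩ := hm x hx
      obtain ⟨n, hnG, ni, nx⟩ := hm (s x) (s0 x hx)
      have h : w * m = n * w := by
        apply sharp _ (G.mul_mem hwG hmG) _ (G.mul_mem hnG hwG)
        · simp [mi, wi, nx]
        · simp [mx, w0, ni]
        · simp [mx, w1, nx, hsw x hx]
      have h' := DFunLike.congr_fun h (y : OnePoint K)
      rw [Equiv.Perm.mul_apply, Equiv.Perm.mul_apply, mx, hsw y hy, nx, hsw _ (mul_ne_zero hx hy)]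
        at h'
      exact OnePoint.coe_injective h'
    · exact s0
    · intro x hx
      have := hww x
      rw [hsw x hx, hsw _ (s0 x hx)] at this
      exact OnePoint.coe_injective this
    · intro x hx hx1
      obtain ⟨m, hmG, mi, mx⟩ := hm (-1) (by simp)
      obtain ⟨n, hnG, ni, nx⟩ := ht 1
      obtain ⟨t, htG, ti, tx⟩ : ∃ t ∈ G, t ∞ = ∞ ∧
          ∀ x : K, t (x : OnePoint K) = ((1 - x : K) : OnePoint K) :=
        ⟨n * m, G.mul_mem hnG hmG, by simp [mi, ni], fun x => by simp [mx, nx, sub_eq_add_neg]⟩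
      have h : w * t * w = t * w * t := by
        apply sharp _ (G.mul_mem (G.mul_mem hwG htG) hwG) _ (G.mul_mem (G.mul_mem htG hwG) htG)
        · simp [wi, ti, tx, w1]
        · simp [w0, ti, tx, w1, wi]
        · simp [w1, tx, w0, ti]
      have h' := DFunLike.congr_fun h (x : OnePoint K)
      have hsx : 1 - s x ≠ 0 := by
        intro h
        apply hx1
        have e : s x = 1 := by linear_combination -h
        have e2 := hsw x hx
        rw [e, ← w1] at e2
        exact OnePoint.coe_injective (w.injective e2)
      simp only [Equiv.Perm.mul_apply, tx, hsw x hx] at h'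
      rw [hsw _ hsx, hsw _ (sub_ne_zero.2 (Ne.symm hx1)), tx] at h'
      exact OnePoint.coe_injective h'
  have gt : ∀ a : K, ∃ g ∈ G ⊓ (MulAction.toPermHom (Matrix.GeneralLinearGroup (Fin 2) K) (OnePoint K)).range,
      g ∞ = ∞ ∧ ∀ x : K, g (x : OnePoint K) = ((a + x : K) : OnePoint K) := by
    intro a
    obtain ⟨g, hg, gi, gx⟩ := ht a
    refine ⟨g, ⟨hg, Matrix.GeneralLinearGroup.mkOfDetNeZero !![1, a; 0, 1] (by simp), ?_⟩, gi, gx⟩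
    ext x
    induction x using OnePoint.rec
    · simp [gi, OnePoint.smul_infty_eq_ite, Matrix.GeneralLinearGroup.mkOfDetNeZero]
    · simp [gx, OnePoint.smul_some_eq_ite, Matrix.GeneralLinearGroup.mkOfDetNeZero, add_comm]
  have gm : ∀ a : K, a ≠ 0 → ∃ g ∈ G ⊓ (MulAction.toPermHom (Matrix.GeneralLinearGroup (Fin 2) K) (OnePoint K)).range,
      g ∞ = ∞ ∧ ∀ x : K, g (x : OnePoint K) = ((a * x : K) : OnePoint K) := by
    intro a ha
    obtain ⟨g, hg, gi, gx⟩ := hm a ha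
    refine ⟨g, ⟨hg, Matrix.GeneralLinearGroup.mkOfDetNeZero !![a, 0; 0, 1] (by simpa), ?_⟩, gi, gx⟩
    ext x
    induction x using OnePoint.rec
    · simp [gi, OnePoint.smul_infty_eq_ite, Matrix.GeneralLinearGroup.mkOfDetNeZero]
    · simp [gx, OnePoint.smul_some_eq_ite, Matrix.GeneralLinearGroup.mkOfDetNeZero]
  have gw : ∃ g ∈ G ⊓ (MulAction.toPermHom (Matrix.GeneralLinearGroup (Fin 2) K) (OnePoint K)).range,
      g ((0:K) : OnePoint K) = ∞ := by
    refine ⟨w, ⟨hwG, Matrix.GeneralLinearGroup.mkOfDetNeZero !![0, 1; 1, 0] (by simp), ?_⟩, w0⟩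
    ext x
    induction x using OnePoint.rec with
    | infty => simp [wi, OnePoint.smul_infty_eq_ite, Matrix.GeneralLinearGroup.mkOfDetNeZero]
    | coe x =>
      by_cases hx : x = 0
      · subst hx
        simp [w0, OnePoint.smul_some_eq_ite, Matrix.GeneralLinearGroup.mkOfDetNeZero]
      · simp [hsw x hx, hinv x hx, hx, OnePoint.smul_some_eq_ite, Matrix.GeneralLinearGroup.mkOfDetNeZero]
  apply le_antisymm
  · exact le_of_gens G _ hs gt gm gw
  · rw [inf_comm] at gt gm gw
    refine le_of_gens _ G ?_ gt gm gw
    rintro _ ⟨A, rfl⟩ hi h0 h1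
    have hi' : A • (∞ : OnePoint K) = ∞ := hi
    have h0' : A • ((0:K) : OnePoint K) = ((0:K) : OnePoint K) := h0
    have h1' : A • ((1:K) : OnePoint K) = ((1:K) : OnePoint K) := h1
    have c := OnePoint.smul_infty_eq_self_iff.1 hi'
    have d : A 1 1 ≠ 0 := by
      intro d
      apply A.det_ne_zero
      rw [Matrix.det_fin_two, c, d]; ring
    rw [OnePoint.smul_some_eq_ite] at h0' h1'
    simp [c, d] at h0'
    simp [c, d, h0'] at h1'
    have e : A 0 0 = A 1 1 := (div_eq_one_iff_eq d).1 h1'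
    ext x
    change A • x = x
    induction x using OnePoint.rec with
    | infty => exact hi'
    | coe x =>
      rw [OnePoint.smul_some_eq_ite]
      simp [c, d, h0', e]

open scoped commutatorElement in
/-- The stabilizer of a point has an abelian normal subgroup that is transitive on the other
points, and two-point stabilizers are abelian. -/
theorem exists_translations {X : Type*} (G : Subgroup (Equiv.Perm X))
    (h3 : ∀ x₁ x₂ x₃ y₁ y₂ y₃ : X,
      x₁ ≠ x₂ → x₁ ≠ x₃ → x₂ ≠ x₃ → y₁ ≠ y₂ → y₁ ≠ y₃ → y₂ ≠ y₃ →
      ∃ g ∈ G, g x₁ = y₁ ∧ g x₂ = y₂ ∧ g x₃ = y₃)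
    (o z u : X) (hoz : o ≠ z) (hou : o ≠ u) (hzu : z ≠ u)
    (hmet : derivedSeries ↥(G ⊓ MulAction.stabilizer (Equiv.Perm X) o) 2 = ⊥) :
    ∃ A : Subgroup (Equiv.Perm X), (∀ a ∈ A, a ∈ G ∧ a o = o) ∧
      (∀ a ∈ A, ∀ b ∈ A, a * b = b * a) ∧
      (∀ h ∈ G, h o = o → ∀ a ∈ A, h * a * h⁻¹ ∈ A) ∧
      (∀ p q, p ≠ o → q ≠ o → ∃ a ∈ A, a p = q) ∧
      (∀ a ∈ G, ∀ b ∈ G, a o = o → a z = z → b o = o → b z = z → a * b = b * a) := by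
  set H := G ⊓ MulAction.stabilizer (Equiv.Perm X) o with hH
  have memH : ∀ g, g ∈ H ↔ g ∈ G ∧ g o = o := by
    intro g; simp [hH, Subgroup.mem_inf, MulAction.mem_stabilizer_iff]
  have hDD : ⁅(⁅H, H⁆ : Subgroup (Equiv.Perm X)), ⁅H, H⁆⁆ = ⊥ := by
    have h := congrArg (Subgroup.map H.subtype) hmet
    rw [derivedSeries_succ, derivedSeries_succ, derivedSeries_zero, Subgroup.map_commutator,
      Subgroup.map_commutator, Subgroup.map_bot, ← MonoidHom.range_eq_map,
      Subgroup.range_subtype] at h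
    exact h
  have hDH : ⁅H, H⁆ ≤ H := Subgroup.commutator_le.2 fun a ha b hb => by
    rw [commutatorElement_def]
    exact H.mul_mem (H.mul_mem (H.mul_mem ha hb) (H.inv_mem ha)) (H.inv_mem hb)
  have comm_of : ∀ B : Subgroup (Equiv.Perm X), ⁅B, B⁆ = ⊥ →
      ∀ a ∈ B, ∀ b ∈ B, a * b = b * a := by
    intro B hB a ha b hb
    have := Subgroup.commutator_mem_commutator ha hb
    rw [hB, Subgroup.mem_bot] at this
    exact commutatorElement_eq_one_iff_mul_comm.1 this
  -- 2-transitivity of `H`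
  have h2 : ∀ p q p' q', p ≠ o → q ≠ o → p ≠ q → p' ≠ o → q' ≠ o → p' ≠ q' →
      ∃ h ∈ H, h p = p' ∧ h q = q' := by
    intro p q p' q' a1 a2 a3 a4 a5 a6
    obtain ⟨g, hg, e1, e2, e3⟩ := h3 o p q o p' q' a1.symm a2.symm a3 a4.symm a5.symm a6
    exact ⟨g, (memH g).2 ⟨hg, e1⟩, e2, e3⟩
  by_cases hD : ⁅H, H⁆ = ⊥
  · have hc := comm_of H hD
    refine ⟨H, fun a ha => (memH a).1 ha, hc, ?_, ?_, ?_⟩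
    · intro h hh ho a ha
      have := (memH h).2 ⟨hh, ho⟩
      exact H.mul_mem (H.mul_mem this ha) (H.inv_mem this)
    · intro p q hp hq
      by_cases hpq : p = q
      · exact ⟨1, H.one_mem, by simp [hpq]⟩
      · obtain ⟨h, hh, e, -⟩ := h2 p q q p hp hq hpq hq hp (Ne.symm hpq)
        exact ⟨h, hh, e⟩
    · intro a ha b hb ao _ bo _
      exact hc a ((memH a).2 ⟨ha, ao⟩) b ((memH b).2 ⟨hb, bo⟩)
  · have hc := comm_of _ hDD
    have hnorm : ∀ h ∈ G, h o = o → ∀ a ∈ (⁅H, H⁆ : Subgroup (Equiv.Perm X)), h * a * h⁻¹ ∈ (⁅H, H⁆ : Subgroup (Equiv.Perm X)) := by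
      intro h hh ho a ha
      have hhH := (memH h).2 ⟨hh, ho⟩
      have := Subgroup.commutator_mem_commutator hhH (hDH ha)
      have e : h * a * h⁻¹ = ⁅h, a⁆ * a := by rw [commutatorElement_def]; group
      rw [e]
      exact Subgroup.mul_mem _ this ha
    have htr : ∀ p q, p ≠ o → q ≠ o → ∃ a ∈ (⁅H, H⁆ : Subgroup (Equiv.Perm X)), a p = q := by
      intro p q hp hq
      by_cases hpq : p = q
      · exact ⟨1, Subgroup.one_mem _, by simp [hpq]⟩
      obtain ⟨⟨d, hd⟩, hd1'⟩ := Subgroup.ne_bot_iff_exists_ne_one.1 hD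
      have hd1 : d ≠ 1 := fun h => hd1' (Subtype.ext h)
      obtain ⟨y, hy⟩ : ∃ y, d y ≠ y := by
        by_contra! hcon
        exact hd1 (Equiv.ext hcon)
      have hdo : d o = o := ((memH d).1 (hDH hd)).2
      have hyo : y ≠ o := by rintro rfl; exact hy hdo
      have hdyo : d y ≠ o := fun h => hyo (d.injective (h.trans hdo.symm))
      obtain ⟨h, hh, e1, e2⟩ := h2 y (d y) p q hyo hdyo (Ne.symm hy) hp hq hpq
      have hh' := (memH h).1 hh
      refine ⟨h * d * h⁻¹, hnorm h hh'.1 hh'.2 d hd, ?_⟩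
      rw [Equiv.Perm.mul_apply, Equiv.Perm.mul_apply, Equiv.Perm.inv_eq_iff_eq.2 e1.symm, e2]
    refine ⟨⁅H, H⁆, fun a ha => (memH a).1 (hDH ha), hc, hnorm, htr, ?_⟩
    intro a ha b hb ao az bo bz
    have hab := Subgroup.commutator_mem_commutator ((memH a).2 ⟨ha, ao⟩) ((memH b).2 ⟨hb, bo⟩)
    have hoo := ((memH _).1 (hDH hab)).2
    have hz : ⁅a, b⁆ z = z := by
      rw [commutatorElement_def]
      have h1 : a⁻¹ z = z := by rw [Equiv.Perm.inv_eq_iff_eq, az]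
      have h2 : b⁻¹ z = z := by rw [Equiv.Perm.inv_eq_iff_eq, bz]
      simp only [Equiv.Perm.mul_apply]
      rw [h2, h1, bz, az]
    apply commutatorElement_eq_one_iff_mul_comm.1
    ext x
    by_cases hx : x = o
    · rw [hx, hoo]; rfl
    obtain ⟨c, hcD, hcx⟩ := htr z x hoz.symm hx
    rw [← hcx, ← Equiv.Perm.mul_apply, hc _ hab _ hcD, Equiv.Perm.mul_apply, hz]
    rfl

theorem exists_field {X : Type*} (G A : Subgroup (Equiv.Perm X)) (o z u : X)
    (hoz : o ≠ z) (hou : o ≠ u) (hzu : z ≠ u)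
    (hAG : ∀ a ∈ A, a ∈ G ∧ a o = o)
    (hAc : ∀ a ∈ A, ∀ b ∈ A, a * b = b * a)
    (hAn : ∀ h ∈ G, h o = o → ∀ a ∈ A, h * a * h⁻¹ ∈ A)
    (hAt : ∀ p q, p ≠ o → q ≠ o → ∃ a ∈ A, a p = q)
    (hMc : ∀ a ∈ G, ∀ b ∈ G, a o = o → a z = z → b o = o → b z = z → a * b = b * a)
    (hMt : ∀ p q, p ≠ o → p ≠ z → q ≠ o → q ≠ z → ∃ m ∈ G, m o = o ∧ m z = z ∧ m p = q) :
    ∃ F : Field {x : X // x ≠ o},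
      ((0 : {x : X // x ≠ o}) : X) = z ∧ ((1 : {x : X // x ≠ o}) : X) = u ∧
      (∀ a : {x : X // x ≠ o}, ∃ g ∈ G, g o = o ∧
        ∀ x : {x : X // x ≠ o}, g x = ((a + x : {x : X // x ≠ o}) : X)) ∧
      (∀ a : {x : X // x ≠ o}, a ≠ 0 → ∃ g ∈ G, g o = o ∧
        ∀ x : {x : X // x ≠ o}, g x = ((a * x : {x : X // x ≠ o}) : X)) := by
  classical
  have hAu : ∀ a ∈ A, ∀ b ∈ A, a z = b z → a = b := by
    intro a ha b hb h
    ext x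
    by_cases hx : x = o
    · rw [hx, (hAG a ha).2, (hAG b hb).2]
    obtain ⟨c, hc, rfl⟩ := hAt z x hoz.symm hx
    rw [← Equiv.Perm.mul_apply, hAc a ha c hc, Equiv.Perm.mul_apply, h, ← Equiv.Perm.mul_apply,
      hAc c hc b hb, Equiv.Perm.mul_apply]
  have hMu : ∀ a ∈ G, ∀ b ∈ G, a o = o → a z = z → b o = o → b z = z → a u = b u → a = b := by
    intro a ha b hb ao az bo bz h
    ext x
    by_cases hx : x = o
    · rw [hx, ao, bo]
    by_cases hxz : x = z
    · rw [hxz, az, bz]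
    obtain ⟨c, hc, co, cz, rfl⟩ := hMt u x hou.symm hzu.symm hx hxz
    rw [← Equiv.Perm.mul_apply, hMc a ha c hc ao az co cz, Equiv.Perm.mul_apply, h,
      ← Equiv.Perm.mul_apply, hMc c hc b hb co cz bo bz, Equiv.Perm.mul_apply]
  have hTe : ∀ y : {x : X // x ≠ o}, ∃ a ∈ A, a z = y := fun y => hAt z y hoz.symm y.2
  choose T hTA hTz using hTe
  have hTo : ∀ y, T y o = o := fun y => (hAG _ (hTA y)).2
  have hMe : ∀ y : {x : X // x ≠ o}, ∃ m ∈ G, m o = o ∧ m z = z ∧ ((y : X) ≠ z → m u = y) := by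
    intro y
    by_cases hy : (y : X) = z
    · exact ⟨1, G.one_mem, rfl, rfl, fun h => absurd hy h⟩
    · obtain ⟨m, a, b, c, d⟩ := hMt u y hou.symm hzu.symm y.2 hy
      exact ⟨m, a, b, c, fun _ => d⟩
  choose M hMG hMo hMz hMy using hMe
  have stay : ∀ g : Equiv.Perm X, g o = o → ∀ y : X, y ≠ o → g y ≠ o := fun g hg y hy h =>
    hy (g.injective (h.trans hg.symm))
  have stayz : ∀ g : Equiv.Perm X, g z = z → ∀ y : X, y ≠ z → g y ≠ z := fun g hg y hy h =>
    hy (g.injective (h.trans hg.symm))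
  let K := {x : X // x ≠ o}
  let add : K → K → K := fun x y => ⟨T x y, stay _ (hTo x) y y.2⟩
  let zero : K := ⟨z, hoz.symm⟩
  let one : K := ⟨u, hou.symm⟩
  let mul : K → K → K := fun x y => if (x : X) = z then zero else ⟨M x y, stay _ (hMo x) y y.2⟩
  have inv_o : ∀ y, (T y)⁻¹ o = o := fun y => by rw [Equiv.Perm.inv_eq_iff_eq, hTo]
  let neg : K → K := fun x => ⟨(T x)⁻¹ z, stay _ (inv_o x) z hoz.symm⟩
  have hTadd : ∀ x y : K, T (add x y) = T x * T y := by
    intro x y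
    apply hAu _ (hTA _) _ (A.mul_mem (hTA _) (hTA _))
    rw [Equiv.Perm.mul_apply, hTz, hTz]
  have hTneg : ∀ x : K, T (neg x) = (T x)⁻¹ := by
    intro x
    apply hAu _ (hTA _) _ (A.inv_mem (hTA _))
    rw [hTz]
  have hTzero : T zero = 1 := hAu _ (hTA _) _ A.one_mem (by rw [hTz]; rfl)
  have hMone : M one = 1 := hMu _ (hMG _) _ G.one_mem (hMo _) (hMz _) rfl rfl
    (by rw [hMy one hzu.symm]; rfl)
  have mulz : ∀ x y : K, (x : X) = z → mul x y = zero := fun x y h => by simp only [mul, if_pos h]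
  have mulnz : ∀ x y : K, (x : X) ≠ z → (mul x y : X) = M x y := fun x y h => by
    simp only [mul, if_neg h]
  have mulz' : ∀ x y : K, (y : X) = z → mul x y = zero := fun x y h => by
    by_cases hx : (x : X) = z
    · exact mulz x y hx
    · apply Subtype.ext
      rw [mulnz x y hx, h, hMz]
  have hmulnz : ∀ x y : K, (x : X) ≠ z → (y : X) ≠ z → (mul x y : X) ≠ z := fun x y hx hy => by
    rw [mulnz x y hx]; exact stayz _ (hMz x) _ hy
  have hMmul : ∀ x y : K, (x : X) ≠ z → (y : X) ≠ z → M (mul x y) = M x * M y := by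
    intro x y hx hy
    apply hMu _ (hMG _) _ (G.mul_mem (hMG _) (hMG _)) (hMo _) (hMz _)
    · rw [Equiv.Perm.mul_apply, hMo, hMo]
    · rw [Equiv.Perm.mul_apply, hMz, hMz]
    · rw [Equiv.Perm.mul_apply, hMy _ (hmulnz x y hx hy), hMy y hy, mulnz x y hx]
  have mulassoc : ∀ x y w : K, mul (mul x y) w = mul x (mul y w) := by
    intro x y w
    by_cases hx : (x : X) = z
    · rw [mulz x y hx, mulz _ _ rfl, mulz _ _ hx]
    by_cases hy : (y : X) = z
    · rw [mulz' x y hy, mulz y _ hy, mulz _ _ rfl, mulz' _ _ rfl]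
    apply Subtype.ext
    rw [mulnz _ _ (hmulnz x y hx hy), hMmul x y hx hy, mulnz _ _ hx, mulnz _ _ hy,
      Equiv.Perm.mul_apply]
  have mulcomm : ∀ x y : K, mul x y = mul y x := by
    intro x y
    by_cases hx : (x : X) = z
    · rw [mulz _ _ hx, mulz' _ _ hx]
    by_cases hy : (y : X) = z
    · rw [mulz _ _ hy, mulz' _ _ hy]
    apply Subtype.ext
    have h1 := hMy _ (hmulnz x y hx hy)
    have h2 := hMy _ (hmulnz y x hy hx)
    rw [← h1, ← h2, hMmul _ _ hx hy, hMmul _ _ hy hx,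
      hMc _ (hMG x) _ (hMG y) (hMo x) (hMz x) (hMo y) (hMz y)]
  have addcomm : ∀ x y : K, add x y = add y x := by
    intro x y
    apply Subtype.ext
    rw [← hTz (add x y), ← hTz (add y x), hTadd, hTadd, hAc _ (hTA x) _ (hTA y)]
  have leftdistrib : ∀ x y w : K, mul x (add y w) = add (mul x y) (mul x w) := by
    intro x y w
    by_cases hx : (x : X) = z
    · rw [mulz _ _ hx, mulz _ _ hx, mulz _ _ hx]
      apply Subtype.ext
      change z = T zero z
      rw [hTzero]; rfl
    have hc : M x * T y * (M x)⁻¹ = T (mul x y) := by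
      apply hAu _ (hAn _ (hMG x) (hMo x) _ (hTA y)) _ (hTA _)
      have : (M x)⁻¹ z = z := by rw [Equiv.Perm.inv_eq_iff_eq, hMz]
      rw [hTz, mulnz _ _ hx, Equiv.Perm.mul_apply, Equiv.Perm.mul_apply, this, hTz]
    apply Subtype.ext
    rw [mulnz _ _ hx]
    change M x (T y w) = T (mul x y) (mul x w)
    rw [← hc, mulnz _ _ hx]
    simp
  let R : CommRing K :=
    { add := add
      zero := zero
      neg := neg
      mul := mul
      one := one
      nsmul := @nsmulRec K ⟨zero⟩ ⟨add⟩
      zsmul := @zsmulRec K ⟨zero⟩ ⟨add⟩ ⟨neg⟩ (@nsmulRec K ⟨zero⟩ ⟨add⟩)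
      add_assoc := fun x y w => by
        apply Subtype.ext
        change T (add x y) w = T x (T y w)
        rw [hTadd, Equiv.Perm.mul_apply]
      zero_add := fun x => by
        apply Subtype.ext
        change T zero x = x
        rw [hTzero]; rfl
      add_zero := fun x => by
        apply Subtype.ext
        change T x z = x
        rw [hTz]
      neg_add_cancel := fun x => by
        apply Subtype.ext
        change T (neg x) x = z
        rw [hTneg, Equiv.Perm.inv_eq_iff_eq, hTz]
      add_comm := addcomm
      mul_assoc := mulassoc
      mul_comm := mulcomm
      one_mul := fun x => by
        apply Subtype.ext
        refine (mulnz one x hzu.symm).trans ?_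
        rw [hMone]; rfl
      mul_one := fun x => by
        refine (mulcomm x one).trans ?_
        apply Subtype.ext
        refine (mulnz one x hzu.symm).trans ?_
        rw [hMone]; rfl
      zero_mul := fun x => mulz _ _ rfl
      mul_zero := fun x => mulz' _ _ rfl
      left_distrib := leftdistrib
      right_distrib := fun x y w => by
        refine (mulcomm _ _).trans ((leftdistrib _ _ _).trans ?_)
        rw [mulcomm w x, mulcomm w y]
        rfl }
  have hne : ∀ x : K, x ≠ zero → (x : X) ≠ z := fun x hx h => hx (Subtype.ext h)
  have hF : IsField K :=
    { exists_pair_ne := ⟨zero, one, fun h => hzu (congrArg Subtype.val h)⟩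
      mul_comm := mulcomm
      mul_inv_cancel := fun {x} hx => by
        have hx' := hne x hx
        have io : (M x)⁻¹ o = o := by rw [Equiv.Perm.inv_eq_iff_eq, hMo]
        refine ⟨⟨(M x)⁻¹ u, stay _ io _ hou.symm⟩, ?_⟩
        apply Subtype.ext
        refine (mulnz x _ hx').trans ?_
        change M x ((M x)⁻¹ u) = u
        simp }
  refine ⟨hF.toField, rfl, rfl, ?_, ?_⟩
  · intro a
    exact ⟨T a, (hAG _ (hTA a)).1, hTo a, fun x => rfl⟩
  · intro a ha
    exact ⟨M a, hMG a, hMo a, fun x => (mulnz a x (hne a ha)).symm⟩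

universe u

/-- A 3-transitive permutation group on a set with at least three elements whose point
stabilizers are metabelian is the group `PGL₂(k)` acting on the projective line over a
field `k`. -/
theorem pgl2_of_three_transitive_metabelian_stabilizers {X : Type u}
    (hX : ∃ a b c : X, a ≠ b ∧ a ≠ c ∧ b ≠ c)
    (G : Subgroup (Equiv.Perm X))
    (h3 : ∀ x₁ x₂ x₃ y₁ y₂ y₃ : X,
      x₁ ≠ x₂ → x₁ ≠ x₃ → x₂ ≠ x₃ → y₁ ≠ y₂ → y₁ ≠ y₃ → y₂ ≠ y₃ →
      ∃ g ∈ G, g x₁ = y₁ ∧ g x₂ = y₂ ∧ g x₃ = y₃)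
    (hmet : ∀ x : X,
      derivedSeries ↥(G ⊓ MulAction.stabilizer (Equiv.Perm X) x) 2 = ⊥) :
    ∃ (k : Type u) (_ : Field k) (e : X ≃ Projectivization k (Fin 2 → k)),
      ∀ g : Equiv.Perm X, g ∈ G ↔
        ∃ T : (Fin 2 → k) ≃ₗ[k] (Fin 2 → k),
          ∀ x : X, e (g x) = Projectivization.map T.toLinearMap T.injective (e x) := by
  classical
  obtain ⟨o, z, u, hoz, hou, hzu⟩ := hX
  obtain ⟨A, hAG, hAc, hAn, hAt, hMc⟩ := exists_translations G h3 o z u hoz hou hzu (hmet o)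
  have hMt : ∀ p q, p ≠ o → p ≠ z → q ≠ o → q ≠ z → ∃ m ∈ G, m o = o ∧ m z = z ∧ m p = q :=
    fun p q a b c d => h3 o z p o z q hoz a.symm b.symm hoz c.symm d.symm
  obtain ⟨F, h0, h1, ht, hm⟩ := exists_field G A o z u hoz hou hzu hAG hAc hAn hAt hMc hMt
  let K := {x : X // x ≠ o}
  let E : X ≃ OnePoint K := (Equiv.optionSubtypeNe o).symm
  have Eo : E.symm OnePoint.infty = o := rfl
  have Ex : ∀ x : K, E.symm (x : OnePoint K) = x := fun x => rfl
  have Eo' : E o = OnePoint.infty := by rw [← Eo, Equiv.apply_symm_apply]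
  have Ex' : ∀ x : K, E x = (x : OnePoint K) := fun x => by
    rw [← Ex, Equiv.apply_symm_apply]
  let φ : Equiv.Perm X ≃* Equiv.Perm (OnePoint K) := E.permCongrHom
  have φa : ∀ g y, φ g y = E (g (E.symm y)) := fun g y => rfl
  have hG' : G.map φ.toMonoidHom =
      (MulAction.toPermHom (Matrix.GeneralLinearGroup (Fin 2) K) (OnePoint K)).range := by
    apply eq_range_GL
    · rintro _ ⟨g, hg, rfl⟩ ei e0 e1
      have ei' : E (g (E.symm OnePoint.infty)) = OnePoint.infty := ei
      have e0' : E (g (E.symm ((0 : K) : OnePoint K))) = ((0 : K) : OnePoint K) := e0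
      have e1' : E (g (E.symm ((1 : K) : OnePoint K))) = ((1 : K) : OnePoint K) := e1
      rw [← Equiv.eq_symm_apply, Eo] at ei'
      rw [← Equiv.eq_symm_apply, Ex, h0] at e0'
      rw [← Equiv.eq_symm_apply, Ex, h1] at e1'
      have : g = 1 := by
        ext x
        by_cases hx : x = o
        · rw [hx, ei']; rfl
        by_cases hxz : x = z
        · rw [hxz, e0']; rfl
        obtain ⟨c, hc, co, cz, rfl⟩ := hMt u x hou.symm hzu.symm hx hxz
        rw [← Equiv.Perm.mul_apply, hMc g hg c hc ei' e0' co cz, Equiv.Perm.mul_apply, e1']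
        rfl
      rw [this, map_one]
    · intro a
      obtain ⟨g, hg, go, gx⟩ := ht a
      refine ⟨φ g, ⟨g, hg, rfl⟩, ?_, fun x => ?_⟩
      · rw [φa, Eo, go, Eo']
      · rw [φa, Ex, gx, Ex']
    · intro a ha
      obtain ⟨g, hg, go, gx⟩ := hm a ha
      refine ⟨φ g, ⟨g, hg, rfl⟩, ?_, fun x => ?_⟩
      · rw [φa, Eo, go, Eo']
      · rw [φa, Ex, gx, Ex']
    · obtain ⟨w, hw, w1, w2, w3⟩ := h3 o z u z o u hoz hou hzu hoz.symm hzu hou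
      refine ⟨φ w, ⟨w, hw, rfl⟩, ?_, ?_, ?_⟩
      · rw [φa, Ex, h0, w2, Eo']
      · rw [φa, Eo, w1, ← h0, Ex']
      · rw [φa, Ex, h1, w3, ← h1, Ex']
  refine ⟨K, F, E.trans (OnePoint.equivProjectivization K), fun g => ?_⟩
  have hmem : g ∈ G ↔ φ g ∈ G.map φ.toMonoidHom := by
    constructor
    · intro h; exact ⟨g, h, rfl⟩
    · rintro ⟨g', h, e⟩
      rwa [← φ.injective e]
  rw [hmem, hG']
  have smul_map : ∀ (B : Matrix.GeneralLinearGroup (Fin 2) K)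
      (T : (Fin 2 → K) ≃ₗ[K] (Fin 2 → K)), (∀ v, B • v = T v) →
      ∀ x : Projectivization K (Fin 2 → K),
      B • x = Projectivization.map T.toLinearMap T.injective x := by
    intro B T hBT x
    induction x with
    | h v hv =>
      rw [Projectivization.smul_mk, Projectivization.map_mk]
      congr 1
      exact hBT v
  have equiv_iff : ∀ (B : Matrix.GeneralLinearGroup (Fin 2) K)
      (T : (Fin 2 → K) ≃ₗ[K] (Fin 2 → K)), (∀ v, B • v = T v) →
      (MulAction.toPermHom _ _ B = φ g ↔ ∀ x : X,
        (E.trans (OnePoint.equivProjectivization K)) (g x) =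
        Projectivization.map T.toLinearMap T.injective
          ((E.trans (OnePoint.equivProjectivization K)) x)) := by
    intro B T hBT
    rw [Equiv.ext_iff, ← E.forall_congr_right]
    refine forall_congr' fun x => ?_
    rw [φa, Equiv.symm_apply_apply, MulAction.toPermHom_apply, MulAction.toPerm_apply,
      Equiv.trans_apply, Equiv.trans_apply, ← smul_map B T hBT,
      ← OnePoint.equivProjectivization_smul, EmbeddingLike.apply_eq_iff_eq, eq_comm]
  constructor
  · rintro ⟨B, hB⟩
    exact ⟨(Matrix.GeneralLinearGroup.toLin B).toLinearEquiv,
      (equiv_iff B _ fun v => by rfl).1 hB⟩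
  · rintro ⟨T, hT⟩
    obtain ⟨B, hB⟩ := (Matrix.GeneralLinearGroup.toLin (n := Fin 2) (R := K)).surjective
      (LinearMap.GeneralLinearGroup.ofLinearEquiv T)
    refine ⟨B, (equiv_iff B T fun v => ?_).2 hT⟩
    have : (Matrix.GeneralLinearGroup.toLin B).toLinearEquiv v = T v := by rw [hB]; rfl
    rw [← this]; rfl
end

section
/- Let X be a set containing at least four pairwise distinct elements and let G be a subgroup of the symmetric group of X which is 4-transitive: for all pairwise distinct x₁, …, x₄ ∈ X and all pairwise distinct y₁, …, y₄ ∈ X there exists g ∈ G with g(xᵢ) = yᵢ for i = 1, …, 4. Suppose that for every x ∈ X the point stabilizer G_x = {g ∈ G | g(x) = x} is solvable of derived length at most 3 (its third derived subgroup is trivial). Then G is the full symmetric group of X, and X is finite of cardinality 4 or 5. -/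
open Subgroup in
/-- If `H` normalizes `N`, it normalizes the commutator subgroup of `N`. -/
lemma fourTrans_conj_comm {P : Type*} [Group P] (H N : Subgroup P)
    (h : ∀ g ∈ H, ∀ n ∈ N, g * n * g⁻¹ ∈ N) :
    ∀ g ∈ H, ∀ n ∈ ⁅N, N⁆, g * n * g⁻¹ ∈ ⁅N, N⁆ := by
  intro g hg n hn
  have h1 : N.map (MulAut.conj g).toMonoidHom ≤ N := by
    rintro _ ⟨m, hm, rfl⟩
    exact h g hg m hm
  have h2 : (⁅N, N⁆).map (MulAut.conj g).toMonoidHom ≤ ⁅N, N⁆ := by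
    rw [Subgroup.map_commutator]
    exact Subgroup.commutator_mono h1 h1
  exact h2 ⟨n, hn, rfl⟩

lemma fourTrans_comm_of_bot {P : Type*} [Group P] (N : Subgroup P) (h : ⁅N, N⁆ = ⊥) :
    ∀ a ∈ N, ∀ b ∈ N, a * b = b * a := by
  intro a ha b hb
  have := Subgroup.commutator_mem_commutator ha hb
  rw [h, Subgroup.mem_bot] at this
  exact commutatorElement_eq_one_iff_mul_comm.mp this

/-- A nontrivial abelian normal subgroup of a 2-transitive group is regular. -/
lemma fourTrans_regular {X : Type*} (S : Set X) (H N : Subgroup (Equiv.Perm X))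
    (hS : ∀ n ∈ N, ∀ s ∈ S, n s = s)
    (hN : ∀ g ∈ H, ∀ n ∈ N, g * n * g⁻¹ ∈ N)
    (hab : ⁅N, N⁆ = ⊥) (hne : N ≠ ⊥)
    (h2 : ∀ a b u v : X, a ∉ S → b ∉ S → u ∉ S → v ∉ S → a ≠ b → u ≠ v →
      ∃ h ∈ H, h a = u ∧ h b = v) :
    (∀ u v : X, u ∉ S → v ∉ S → ∃ n ∈ N, n u = v) ∧
    (∀ n ∈ N, ∀ u : X, u ∉ S → n u = u → n = 1) := by
  have ht : ∀ u v : X, u ∉ S → v ∉ S → ∃ n ∈ N, n u = v := by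
    intro u v hu hv
    by_cases huv : u = v
    · exact ⟨1, N.one_mem, by simpa using huv⟩
    obtain ⟨n, hn, hn1⟩ : ∃ n ∈ N, n ≠ 1 := by
      by_contra! hc
      exact hne ((Subgroup.eq_bot_iff_forall N).mpr hc)
    obtain ⟨a, ha⟩ : ∃ a, n a ≠ a := by
      by_contra! hc
      exact hn1 (Equiv.ext hc)
    have haS : a ∉ S := fun h => ha (hS _ hn a h)
    have hbS : n a ∉ S := fun h =>
      ha (n.injective (hS _ hn _ h))
    obtain ⟨h, hh, h_a, h_b⟩ := h2 a _ u v haS hbS hu hv (Ne.symm ha) huv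
    refine ⟨h * n * h⁻¹, hN h hh _ hn, ?_⟩
    have : h⁻¹ u = a := by rw [← h_a]; simp
    simp only [Equiv.Perm.mul_apply, this, h_b]
  refine ⟨ht, ?_⟩
  intro n hn u hu hnu
  ext w
  by_cases hw : w ∈ S
  · simpa using hS n hn w hw
  obtain ⟨m, hm, rfl⟩ := ht u w hu hw
  have := fourTrans_comm_of_bot N hab n hn m hm
  have h3 := congrArg (fun p : Equiv.Perm X => p u) this
  simp only [Equiv.Perm.mul_apply, hnu] at h3
  simpa using h3

lemma fourTrans_nonab {X : Type*} (H : Subgroup (Equiv.Perm X)) (a b c : X) (hbc : c ≠ b)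
    (h1 : ∃ h ∈ H, h a = a ∧ h b = c) (h2 : ∃ h ∈ H, h a = b ∧ h b = a) : ⁅H, H⁆ ≠ ⊥ := by
  intro hb
  obtain ⟨h, hh, h_a, h_b⟩ := h1
  obtain ⟨k, hk, k_a, k_b⟩ := h2
  have h3 := congrArg (fun p : Equiv.Perm X => p a) (fourTrans_comm_of_bot H hb h hh k hk)
  simp only [Equiv.Perm.mul_apply, h_a, k_a, h_b] at h3
  exact hbc h3

lemma fourTrans_no_six {X : Type*} (G : Subgroup (Equiv.Perm X))
    (h4 : ∀ x y : Fin 4 → X, Function.Injective x → Function.Injective y →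
      ∃ g ∈ G, ∀ i : Fin 4, g (x i) = y i)
    (hsolv : ∀ x : X,
      derivedSeries ↥(G ⊓ MulAction.stabilizer (Equiv.Perm X) x) 3 = ⊥)
    (q : Fin 6 → X) (hq : Function.Injective q) : False := by
  have hinj : ∀ a b c d : X, a ≠ b → a ≠ c → a ≠ d → b ≠ c → b ≠ d → c ≠ d →
      Function.Injective ![a, b, c, d] := by
    intro a b c d h1 h2 h3 h4 h5 h6 i j hij
    fin_cases i <;> fin_cases j <;> simp_all
  have t4 : ∀ a b c d a' b' c' d' : X, a ≠ b → a ≠ c → a ≠ d → b ≠ c → b ≠ d → c ≠ d →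
      a' ≠ b' → a' ≠ c' → a' ≠ d' → b' ≠ c' → b' ≠ d' → c' ≠ d' →
      ∃ g ∈ G, g a = a' ∧ g b = b' ∧ g c = c' ∧ g d = d' := by
    intro a b c d a' b' c' d' h1 h2 h3 h4' h5 h6 k1 k2 k3 k4 k5 k6
    obtain ⟨g, hg, hh⟩ := h4 ![a, b, c, d] ![a', b', c', d'] (hinj _ _ _ _ h1 h2 h3 h4' h5 h6)
      (hinj _ _ _ _ k1 k2 k3 k4 k5 k6)
    exact ⟨g, hg, hh 0, hh 1, hh 2, hh 3⟩
  -- avoid at most five points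
  have av : ∀ s : Finset X, s.card ≤ 5 → ∃ w, w ∉ s := by
    classical
    intro s hs
    by_contra! hc
    have := Finset.card_le_card (s := Finset.univ.image q) (t := s) (fun w _ => hc w)
    rw [Finset.card_image_of_injective _ hq] at this
    simp at this
    omega
  have hne : ∀ i j : Fin 6, i ≠ j → q i ≠ q j := fun i j h h' => h (hq h')
  obtain ⟨x, hx⟩ : ∃ x, x = q 0 := ⟨_, rfl⟩
  obtain ⟨y, hy⟩ : ∃ x, x = q 1 := ⟨_, rfl⟩
  obtain ⟨z, hz⟩ : ∃ x, x = q 2 := ⟨_, rfl⟩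
  obtain ⟨f, hf⟩ : ∃ x, x = q 3 := ⟨_, rfl⟩
  have hxy : x ≠ y := by subst hx hy; exact hne _ _ (by decide)
  have hxz : x ≠ z := by subst hx hz; exact hne _ _ (by decide)
  have hxf : x ≠ f := by subst hx hf; exact hne _ _ (by decide)
  have hyz : y ≠ z := by subst hy hz; exact hne _ _ (by decide)
  have hyf : y ≠ f := by subst hy hf; exact hne _ _ (by decide)
  have hzf : z ≠ f := by subst hz hf; exact hne _ _ (by decide)
  clear hx hy hz hf
  classical
  have av3 : ∀ a b c : X, ∃ w, w ≠ a ∧ w ≠ b ∧ w ≠ c := by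
    intro a b c
    obtain ⟨w, hw⟩ := av {a, b, c} (Finset.card_le_three.trans (by norm_num))
    simp only [Finset.mem_insert, Finset.mem_singleton, not_or] at hw
    exact ⟨w, hw⟩
  have t3 : ∀ b c d b' c' d' : X, b ≠ x → c ≠ x → d ≠ x → b' ≠ x → c' ≠ x → d' ≠ x →
      b ≠ c → b ≠ d → c ≠ d → b' ≠ c' → b' ≠ d' → c' ≠ d' →
      ∃ g ∈ G, g x = x ∧ g b = b' ∧ g c = c' ∧ g d = d' := by
    intro b c d b' c' d' h1 h2 h3 h4 h5 h6 h7 h8 h9 h10 h11 h12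
    exact t4 x b c d x b' c' d' h1.symm h2.symm h3.symm h7 h8 h9 h4.symm h5.symm h6.symm h10 h11 h12
  set H : Subgroup (Equiv.Perm X) := G ⊓ MulAction.stabilizer (Equiv.Perm X) x with hH
  have memH : ∀ g, g ∈ H ↔ g ∈ G ∧ g x = x := by
    intro g; rw [hH, Subgroup.mem_inf, MulAction.mem_stabilizer_iff]; rfl
  have hD3 : ⁅⁅⁅H, H⁆, ⁅H, H⁆⁆, ⁅⁅H, H⁆, ⁅H, H⁆⁆⁆ = ⊥ := by
    have := congrArg (Subgroup.map H.subtype) (hsolv x)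
    change Subgroup.map H.subtype (derivedSeries (↥H) 3) = _ at this
    simpa [derivedSeries_succ, Subgroup.map_commutator, ← MonoidHom.range_eq_map, commutator_def] using this
  have hHself : ∀ g ∈ H, ∀ n ∈ H, g * n * g⁻¹ ∈ H :=
    fun g hg n hn => H.mul_mem (H.mul_mem hg hn) (H.inv_mem hg)
  have hC1 := fourTrans_conj_comm H H hHself
  have hC2 := fourTrans_conj_comm H _ hC1
  have hle1 : ⁅H, H⁆ ≤ H := H.commutator_le_self
  have hle2 : ⁅⁅H, H⁆, ⁅H, H⁆⁆ ≤ H := (Subgroup.commutator_le_self _).trans hle1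
  have hH2 : ∀ a b u v : X, a ∉ ({x} : Set X) → b ∉ ({x} : Set X) → u ∉ ({x} : Set X) →
      v ∉ ({x} : Set X) → a ≠ b → u ≠ v → ∃ h ∈ H, h a = u ∧ h b = v := by
    intro a b u v ha hb hu hv hab huv
    simp only [Set.mem_singleton_iff] at ha hb hu hv
    obtain ⟨c, hc1, hc2, hc3⟩ := av3 x a b
    obtain ⟨w, hw1, hw2, hw3⟩ := av3 x u v
    obtain ⟨g, hg, g0, g1, g2, g3⟩ := t3 a b c u v w ha hb hc1 hu hv hw1 hab hc2.symm hc3.symm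
      huv hw2.symm hw3.symm
    exact ⟨g, (memH g).2 ⟨hg, g0⟩, g1, g2⟩
  have hnab : ⁅H, H⁆ ≠ ⊥ := fourTrans_nonab H y z f hzf.symm
    (hH2 _ _ _ _ hxy.symm hxz.symm hxy.symm hxf.symm hyz hyf)
    (hH2 _ _ _ _ hxy.symm hxz.symm hxz.symm hxy.symm hyz hyz.symm)
  -- K is the stabilizer of x and y
  obtain ⟨K, hK⟩ : ∃ K, K = H ⊓ MulAction.stabilizer (Equiv.Perm X) y := ⟨_, rfl⟩
  have memK : ∀ g, g ∈ K ↔ g ∈ G ∧ g x = x ∧ g y = y := by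
    intro g
    rw [hK, Subgroup.mem_inf, MulAction.mem_stabilizer_iff, memH, and_assoc]; rfl
  have hKH : K ≤ H := hK ▸ inf_le_left
  have hKc1 : ⁅K, K⁆ ≤ ⁅H, H⁆ := Subgroup.commutator_mono hKH hKH
  have hKc2 : ⁅⁅K, K⁆, ⁅K, K⁆⁆ ≤ ⁅⁅H, H⁆, ⁅H, H⁆⁆ := Subgroup.commutator_mono hKc1 hKc1
  have hKle1 : ⁅K, K⁆ ≤ K := K.commutator_le_self
  have hKle2 : ⁅⁅K, K⁆, ⁅K, K⁆⁆ ≤ K := (Subgroup.commutator_le_self _).trans hKle1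
  -- the regular abelian normal subgroup
  obtain ⟨A, hAH, hAn, hAab, hAne, hAK⟩ : ∃ A : Subgroup (Equiv.Perm X), A ≤ H ∧
      (∀ g ∈ H, ∀ n ∈ A, g * n * g⁻¹ ∈ A) ∧ ⁅A, A⁆ = ⊥ ∧ A ≠ ⊥ ∧ ⁅⁅K, K⁆, ⁅K, K⁆⁆ ≤ A := by
    by_cases h : ⁅⁅H, H⁆, ⁅H, H⁆⁆ = ⊥
    · exact ⟨⁅H, H⁆, hle1, hC1, h, hnab, hKc2.trans (Subgroup.commutator_le_self _)⟩
    · exact ⟨_, hle2, hC2, hD3, h, hKc2⟩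
  have hAx : ∀ n ∈ A, n x = x := fun n hn => ((memH n).1 (hAH hn)).2
  obtain ⟨hAt, hAr⟩ := fourTrans_regular {x} H A
    (by rintro n hn s rfl; exact hAx n hn) hAn hAab hAne hH2
  simp only [Set.mem_singleton_iff] at hAt hAr
  have hAcomm := fourTrans_comm_of_bot A hAab
  have hKmet : ⁅⁅K, K⁆, ⁅K, K⁆⁆ = ⊥ := by
    rw [eq_bot_iff]
    intro n hn
    exact hAr n (hAK hn) y hxy.symm ((memK n).1 (hKle2 hn)).2.2
  have hK2 : ∀ a b u v : X, a ∉ ({x, y} : Set X) → b ∉ ({x, y} : Set X) → u ∉ ({x, y} : Set X) →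
      v ∉ ({x, y} : Set X) → a ≠ b → u ≠ v → ∃ h ∈ K, h a = u ∧ h b = v := by
    intro a b u v ha hb hu hv hab huv
    simp only [Set.mem_insert_iff, Set.mem_singleton_iff, not_or] at ha hb hu hv
    obtain ⟨g, hg, g0, g1, g2, g3⟩ := t3 y a b y u v hxy.symm ha.1 hb.1 hxy.symm hu.1 hv.1
      (Ne.symm ha.2) (Ne.symm hb.2) hab (Ne.symm hu.2) (Ne.symm hv.2) huv
    exact ⟨g, (memK g).2 ⟨hg, g0, g1⟩, g2, g3⟩
  have hKself : ∀ g ∈ K, ∀ n ∈ K, g * n * g⁻¹ ∈ K :=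
    fun g hg n hn => K.mul_mem (K.mul_mem hg hn) (K.inv_mem hg)
  have hzS : z ∉ ({x, y} : Set X) := by simp [hxz.symm, hyz.symm]
  have hfS : f ∉ ({x, y} : Set X) := by simp [hxf.symm, hyf.symm]
  obtain ⟨e, he1, he2, he3, he4⟩ : ∃ e, e ≠ x ∧ e ≠ y ∧ e ≠ z ∧ e ≠ f := by
    obtain ⟨w, hw⟩ := av {x, y, z, f} (Finset.card_le_four.trans (by norm_num))
    simp only [Finset.mem_insert, Finset.mem_singleton, not_or] at hw
    exact ⟨w, hw⟩
  have heS : e ∉ ({x, y} : Set X) := by simp [he1, he2]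
  have hKnab : ⁅K, K⁆ ≠ ⊥ := fourTrans_nonab K z f e he4
    (hK2 _ _ _ _ hzS hfS hzS heS hzf he3.symm) (hK2 _ _ _ _ hzS hfS hfS hzS hzf hzf.symm)
  obtain ⟨-, hBr⟩ := fourTrans_regular {x, y} K ⁅K, K⁆
    (by
      intro n hn s hs
      have := (memK n).1 (hKle1 hn)
      rcases hs with rfl | rfl
      · exact this.2.1
      · exact this.2.2)
    (fourTrans_conj_comm K K hKself) hKmet hKnab hK2
  -- the stabilizer of three points is abelian
  have hL : ∀ s ∈ K, ∀ t ∈ K, s z = z → t z = z → s * t = t * s := by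
    intro s hs t ht hsz htz
    have hsz' : s⁻¹ z = z := by rw [Equiv.Perm.inv_eq_iff_eq]; exact hsz.symm
    have htz' : t⁻¹ z = z := by rw [Equiv.Perm.inv_eq_iff_eq]; exact htz.symm
    have := hBr (s * t * s⁻¹ * t⁻¹) (Subgroup.commutator_mem_commutator hs ht) z hzS
      (by simp only [Equiv.Perm.mul_apply, hsz, htz, hsz', htz'])
    exact commutatorElement_eq_one_iff_mul_comm.mp this
  -- two elements of A that agree at a point are equal
  have hAeq : ∀ m ∈ A, ∀ n ∈ A, ∀ u, u ≠ x → m u = n u → m = n := by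
    intro m hm n hn u hu h
    have := hAr (n⁻¹ * m) (A.mul_mem (A.inv_mem hn) hm) u hu (by simp [h])
    exact (inv_mul_eq_one.mp this).symm
  have hAnx : ∀ n ∈ A, ∀ u, u ≠ x → n u ≠ x := by
    intro n hn u hu h
    exact hu (n.injective (h.trans (hAx n hn).symm))
  -- conjugation by elements of K
  have hconj : ∀ k ∈ K, ∀ m ∈ A, ∀ n ∈ A, k (m y) = n y → k * m = n * k := by
    intro k hk m hm n hn h
    have hky : k⁻¹ y = y := by
      rw [Equiv.Perm.inv_eq_iff_eq]; exact ((memK k).1 hk).2.2.symm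
    have := hAeq _ (hAn k (hKH hk) m hm) n hn y hxy.symm
      (by simp only [Equiv.Perm.mul_apply, hky, h])
    rw [← this]; group
  obtain ⟨a, ha, hay⟩ := hAt y z hxy.symm hxz.symm
  obtain ⟨b, hb, hby⟩ := hAt y f hxy.symm hxf.symm
  have haa : a * a = 1 := by
    by_contra hne1
    have p1 : a⁻¹ y ≠ x := hAnx _ (A.inv_mem ha) y hxy.symm
    have p2 : a⁻¹ y ≠ y := by
      intro h; rw [Equiv.Perm.inv_eq_iff_eq, hay] at h; exact hyz h
    have p3 : a⁻¹ y ≠ z := by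
      intro h
      rw [Equiv.Perm.inv_eq_iff_eq] at h
      exact hne1 (hAr _ (A.mul_mem ha ha) y hxy.symm (by simp [hay, ← h]))
    obtain ⟨w, hw⟩ := av {x, y, z, a⁻¹ y} (Finset.card_le_four.trans (by norm_num))
    simp only [Finset.mem_insert, Finset.mem_singleton, not_or] at hw
    obtain ⟨w1, w2, w3, w4⟩ := hw
    obtain ⟨k, hk, kz, kw⟩ := hK2 z (a⁻¹ y) z w hzS (by rintro (h | h); exacts [p1 h, p2 h]) hzS (by simp [w1, w2])
      p3.symm (Ne.symm w3)
    have hc : k * a = a * k := hconj k hk a ha a ha (by rw [hay, kz])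
    have h3 := congrArg (fun p : Equiv.Perm X => p (a⁻¹ y)) hc
    have hinv : a (a⁻¹ y) = y := a.apply_symm_apply y
    simp only [Equiv.Perm.mul_apply, hinv, kw, ((memK k).1 hk).2.2] at h3
    apply w4
    rw [Eq.comm, Equiv.Perm.inv_eq_iff_eq]
    exact h3
  have haa' : ∀ u, a (a u) = u := fun u => by rw [← Equiv.Perm.mul_apply, haa]; rfl
  have hab' : a * b = b * a := hAcomm a ha b hb
  have habu : ∀ u, a (b u) = b (a u) := fun u => by
    rw [← Equiv.Perm.mul_apply, hab']; rfl
  have haz : a z = y := by rw [← hay, haa']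
  have hfx : ∀ u, u ≠ x → a u ≠ u := by
    intro u hu h
    have := hAr a ha u hu h
    rw [this] at hay; exact hyz hay
  have hafS : ∀ u, u ≠ x → u ≠ y → u ≠ z → a u ≠ x ∧ a u ≠ y ∧ a u ≠ z := by
    intro u h1 h2 h3
    refine ⟨hAnx a ha u h1, fun h => h3 (a.injective (h.trans haz.symm)),
      fun h => h2 (a.injective (h.trans hay.symm))⟩
  obtain ⟨q1, q2, q3⟩ := hafS f hxf.symm hyf.symm hzf.symm
  obtain ⟨s, hs, sz, sf⟩ := hK2 z f z (a f) hzS hfS hzS (by simp [q1, q2]) hzf q3.symm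
  have hsa : ∀ u, u ≠ x → u ≠ y → u ≠ z → s u = a u := by
    intro u h1 h2 h3
    obtain ⟨t, ht, tz, tf⟩ := hK2 z f z u hzS hfS hzS (by simp [h1, h2]) hzf h3.symm
    have e1 := congrArg (fun p : Equiv.Perm X => p f) (hL s hs t ht sz tz)
    have e2 := congrArg (fun p : Equiv.Perm X => p f)
      (hconj t ht a ha a ha (by rw [hay, tz]))
    simp only [Equiv.Perm.mul_apply, tf, sf] at e1 e2
    rw [e1, e2]
  obtain ⟨g, hg⟩ := av {x, y, z, f, a f} Finset.card_le_five
  simp only [Finset.mem_insert, Finset.mem_singleton, not_or] at hg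
  obtain ⟨g1, g2, g3, g4, g5⟩ := hg
  have b1 : b g ≠ x := hAnx b hb g g1
  have hsb : s * b = (a * b) * s := hconj s hs b hb (a * b) (A.mul_mem ha hb) (by
    rw [hby, sf, Equiv.Perm.mul_apply, hby])
  -- b is also an involution, by transitivity
  have hbb : b * b = 1 := by
    obtain ⟨k, hk, kz, -⟩ := hK2 z f f z hzS hfS hfS hzS hzf hzf.symm
    have hc : k * a = b * k := hconj k hk a ha b hb (by rw [hay, hby, kz])
    have : b = k * a * k⁻¹ := by rw [hc]; group
    rw [this]
    calc k * a * k⁻¹ * (k * a * k⁻¹) = k * (a * a) * k⁻¹ := by group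
      _ = 1 := by rw [haa]; group
  have hbb' : ∀ u, b (b u) = u := fun u => by rw [← Equiv.Perm.mul_apply, hbb]; rfl
  have b2 : b g ≠ y := by
    intro h
    apply g4
    rw [← hby, ← h, hbb']
  have b3 : b g ≠ z := by
    intro h
    apply g5
    rw [← hby, habu, hay, ← h, hbb']
  have e1 := congrArg (fun p : Equiv.Perm X => p g) hsb
  simp only [Equiv.Perm.mul_apply] at e1
  rw [hsa g g1 g2 g3, hsa _ b1 b2 b3, ← habu, haa'] at e1
  exact hfx _ b1 e1

/-- A 4-transitive permutation group on a set with at least four elements whose point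
stabilizers are solvable of derived length at most 3 is the full symmetric group, and the
set is finite of cardinality 4 or 5. -/
theorem symmetric_of_four_transitive_solvable_stabilizers {X : Type*}
    (hX : ∃ x : Fin 4 → X, Function.Injective x)
    (G : Subgroup (Equiv.Perm X))
    (h4 : ∀ x y : Fin 4 → X, Function.Injective x → Function.Injective y →
      ∃ g ∈ G, ∀ i : Fin 4, g (x i) = y i)
    (hsolv : ∀ x : X,
      derivedSeries ↥(G ⊓ MulAction.stabilizer (Equiv.Perm X) x) 3 = ⊥) :
    G = ⊤ ∧ Finite X ∧ (Nat.card X = 4 ∨ Nat.card X = 5) := by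
  classical
  have h6 := fourTrans_no_six G h4 hsolv
  obtain ⟨x, hx⟩ := hX
  have hfin : Finite X := by
    by_contra hinf
    rw [not_finite_iff_infinite] at hinf
    exact h6 (fun i => Infinite.natEmbedding X i)
      (fun i j h => Fin.ext ((Infinite.natEmbedding X).injective h))
  have : Fintype X := Fintype.ofFinite X
  have hc4 : 4 ≤ Fintype.card X := by
    simpa using Fintype.card_le_of_injective x hx
  have hc5 : Fintype.card X ≤ 5 := by
    by_contra hc
    obtain ⟨q⟩ : Nonempty (Fin 6 ↪ X) :=
      Function.Embedding.nonempty_of_card_le (by simp; omega)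
    exact h6 q q.injective
  refine ⟨?_, hfin, by rw [Nat.card_eq_fintype_card]; omega⟩
  rw [eq_top_iff]
  intro p _
  obtain ⟨g, hg, hgp⟩ := h4 x (fun i => p (x i)) hx (p.injective.comp hx)
  have hpg : g⁻¹ * p = 1 := by
    have hfix : ∀ i, (g⁻¹ * p) (x i) = x i := fun i => by
      rw [Equiv.Perm.mul_apply, Equiv.Perm.inv_eq_iff_eq]; exact (hgp i).symm
    by_contra hne
    have h2 := Equiv.Perm.two_le_card_support_of_ne_one hne
    have hd : Disjoint (Finset.univ.image x) (g⁻¹ * p).support := by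
      rw [Finset.disjoint_left]
      intro w hw hw'
      obtain ⟨i, -, rfl⟩ := Finset.mem_image.mp hw
      exact (Equiv.Perm.mem_support.mp hw') (hfix i)
    have h3 := Finset.card_le_univ (Finset.univ.image x ∪ (g⁻¹ * p).support)
    rw [Finset.card_union_of_disjoint hd, Finset.card_image_of_injective _ hx] at h3
    simp only [Finset.card_univ, Fintype.card_fin] at h3
    omega
  rw [← inv_mul_eq_one.mp hpg]
  exact hg
end

section
/- Let X be a set containing at least five pairwise distinct elements and let G be a subgroup of the symmetric group of X which is 5-transitive: for all pairwise distinct x₁, …, x₅ ∈ X and all pairwise distinct y₁, …, y₅ ∈ X there exists g ∈ G with g(xᵢ) = yᵢ for i = 1, …, 5. Suppose that for every x ∈ X the point stabilizer G_x = {g ∈ G | g(x) = x} is solvable of derived length at most 4 (its fourth derived subgroup is trivial). Then G is the full symmetric group of X, and X is finite of cardinality 5. -/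
theorem aux_no_abelian {H X : Type*} [Group H] [MulAction H X] [FaithfulSMul H X] (x : X)
    (hx : ∀ h : H, h • x = x)
    (h6 : ∀ a b c d e : X, ∃ y, y ≠ a ∧ y ≠ b ∧ y ≠ c ∧ y ≠ d ∧ y ≠ e)
    (h4 : ∀ a b c d d' : X, a ≠ x → b ≠ x → c ≠ x → d ≠ x → d' ≠ x → a ≠ b → a ≠ c → a ≠ d →
      b ≠ c → b ≠ d → c ≠ d → a ≠ d' → b ≠ d' → c ≠ d' →
      ∃ h : H, h • a = a ∧ h • b = b ∧ h • c = c ∧ h • d = d')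
    (h2 : ∀ a b c d : X, a ≠ x → b ≠ x → c ≠ x → d ≠ x → a ≠ b → c ≠ d →
      ∃ h : H, h • a = c ∧ h • b = d)
    (N : Subgroup H) [N.Normal] (hN : N ≠ ⊥) (hc : ∀ a ∈ N, ∀ b ∈ N, a * b = b * a) : False := by
  have hne : ∀ (h : H) (y : X), y ≠ x → h • y ≠ x := by
    intro h y hy e
    apply hy
    rw [← hx h] at e
    exact MulAction.injective h e
  obtain ⟨⟨n, hn⟩, hn0⟩ := Subgroup.ne_bot_iff_exists_ne_one.1 hN
  have hn1 : n ≠ 1 := fun e => hn0 (Subtype.ext e)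
  obtain ⟨u, hu⟩ : ∃ u : X, n • u ≠ u := by
    by_contra! hh
    exact hn1 (FaithfulSMul.eq_of_smul_eq_smul (α := X) fun a => by rw [hh a, one_smul])
  have hux : u ≠ x := by
    rintro rfl
    exact hu (hx n)
  have htr : ∀ y z : X, y ≠ x → z ≠ x → y ≠ z → ∃ a ∈ N, a • y = z := by
    intro y z hy hz hyz
    obtain ⟨h, e1, e2⟩ := h2 u (n • u) y z hux (hne _ _ hux) hy hz hu.symm hyz
    refine ⟨h * n * h⁻¹, Subgroup.Normal.conj_mem inferInstance n hn h, ?_⟩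
    rw [← e1, ← e2]
    simp [mul_smul]
  have hreg : ∀ a ∈ N, ∀ b ∈ N, ∀ y : X, y ≠ x → a • y = b • y → a = b := by
    intro a ha b hb y hy hab
    apply FaithfulSMul.eq_of_smul_eq_smul (α := X)
    intro z
    by_cases hz : z = x
    · rw [hz, hx, hx]
    by_cases hyz : y = z
    · rw [← hyz, hab]
    obtain ⟨m, hm, rfl⟩ := htr y z hy hz hyz
    rw [← mul_smul, ← mul_smul, hc a ha m hm, hc b hb m hm, mul_smul, mul_smul, hab]
  obtain ⟨v, hvx, hvu, -⟩ := h6 x u u u u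
  obtain ⟨a, ha, hav⟩ := htr u v hux hvx hvu.symm
  obtain ⟨w, hwx, hwu, hwv, hwa, -⟩ := h6 x u v (a⁻¹ • u) u
  obtain ⟨b, hb, hbw⟩ := htr u w hux hwx hwu.symm
  have hd1 : (a * b) • u ≠ u := by
    intro e
    rw [mul_smul, hbw] at e
    exact hwa (eq_inv_smul_iff.2 e)
  have hd2 : (a * b) • u ≠ v := by
    intro e
    rw [mul_smul, hbw, ← hav] at e
    exact hwu (MulAction.injective a e)
  have hd3 : (a * b) • u ≠ w := by
    intro e
    rw [hc a ha b hb, mul_smul, hav, ← hbw] at e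
    exact hvu (MulAction.injective b e)
  obtain ⟨z, hzx, hzu, hzv, hzw, hzd⟩ := h6 x u v w ((a * b) • u)
  obtain ⟨h, e1, e2, e3, e4⟩ := h4 u v w ((a * b) • u) z hux hvx hwx (hne _ _ hux) hzx
    hvu.symm hwu.symm hd1.symm hwv.symm hd2.symm hd3.symm hzu.symm hzv.symm hzw.symm
  have e1' : h⁻¹ • u = u := inv_smul_eq_iff.2 e1.symm
  have ca : h * a * h⁻¹ = a := hreg _ (Subgroup.Normal.conj_mem inferInstance a ha h) _ ha u hux
    (by simp only [mul_smul, e1', hav, e2])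
  have cb : h * b * h⁻¹ = b := hreg _ (Subgroup.Normal.conj_mem inferInstance b hb h) _ hb u hux
    (by simp only [mul_smul, e1', hbw, e3])
  have cab : h * (a * b) * h⁻¹ = a * b := by
    conv_rhs => rw [← ca, ← cb]
    group
  apply hzd
  rw [← e4]
  conv_rhs => rw [← cab]
  simp only [mul_smul, e1']

theorem aux_exists_abelian {H : Type*} [Group H] [Nontrivial H] (n : ℕ)
    (h : derivedSeries H n = ⊥) :
    ∃ N : Subgroup H, N.Normal ∧ N ≠ ⊥ ∧ ∀ a ∈ N, ∀ b ∈ N, a * b = b * a := by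
  induction n with
  | zero => exact absurd h (by simp)
  | succ n ih =>
    by_cases hn : derivedSeries H n = ⊥
    · exact ih hn
    · refine ⟨_, derivedSeries_normal H n, hn, fun a ha b hb => ?_⟩
      have := Subgroup.commutator_mem_commutator ha hb
      rw [← derivedSeries_succ, h, Subgroup.mem_bot] at this
      exact commutatorElement_eq_one_iff_mul_comm.1 this

theorem aux_inj {X : Type*} {a b c d e : X} (h1 : a ≠ b) (h2 : a ≠ c) (h3 : a ≠ d) (h4 : a ≠ e)
    (h5 : b ≠ c) (h6 : b ≠ d) (h7 : b ≠ e) (h8 : c ≠ d) (h9 : c ≠ e) (h10 : d ≠ e) :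
    Function.Injective ![a, b, c, d, e] := by
  intro i j hij
  fin_cases i <;> fin_cases j <;> simp_all

/-- A 5-transitive permutation group on a set with at least five elements whose point
stabilizers are solvable of derived length at most 4 is the full symmetric group, and the
set is finite of cardinality 5. -/
theorem symmetric_of_five_transitive_solvable_stabilizers {X : Type*}
    (hX : ∃ x : Fin 5 → X, Function.Injective x)
    (G : Subgroup (Equiv.Perm X))
    (h5 : ∀ x y : Fin 5 → X, Function.Injective x → Function.Injective y →
      ∃ g ∈ G, ∀ i : Fin 5, g (x i) = y i)
    (hsolv : ∀ x : X,
      derivedSeries ↥(G ⊓ MulAction.stabilizer (Equiv.Perm X) x) 4 = ⊥) :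
    G = ⊤ ∧ Finite X ∧ Nat.card X = 5 := by
  have key : ¬ ∀ a b c d e : X, ∃ y, y ≠ a ∧ y ≠ b ∧ y ≠ c ∧ y ≠ d ∧ y ≠ e := by
    intro h6
    obtain ⟨p, -⟩ := hX
    set x := p 0
    have h4 : ∀ a b c d a' b' c' d' : X, a ≠ x → b ≠ x → c ≠ x → d ≠ x →
        a' ≠ x → b' ≠ x → c' ≠ x → d' ≠ x → a ≠ b → a ≠ c → a ≠ d →
        b ≠ c → b ≠ d → c ≠ d → a' ≠ b' → a' ≠ c' → a' ≠ d' → b' ≠ c' → b' ≠ d' → c' ≠ d' →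
        ∃ h : ↥(G ⊓ MulAction.stabilizer (Equiv.Perm X) x),
          h • a = a' ∧ h • b = b' ∧ h • c = c' ∧ h • d = d' := by
      intro a b c d a' b' c' d' k1 k2 k3 k4 k5 k6 k7 k8 l1 l2 l3 l4 l5 l6 m1 m2 m3 m4 m5 m6
      obtain ⟨g, hg, h⟩ := h5 ![x, a, b, c, d] ![x, a', b', c', d']
        (aux_inj k1.symm k2.symm k3.symm k4.symm l1 l2 l3 l4 l5 l6)
        (aux_inj k5.symm k6.symm k7.symm k8.symm m1 m2 m3 m4 m5 m6)
      exact ⟨⟨g, hg, h 0⟩, h 1, h 2, h 3, h 4⟩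
    have h2 : ∀ a b c d : X, a ≠ x → b ≠ x → c ≠ x → d ≠ x → a ≠ b → c ≠ d →
        ∃ h : ↥(G ⊓ MulAction.stabilizer (Equiv.Perm X) x), h • a = c ∧ h • b = d := by
      intro a b c d k1 k2 k3 k4 k5 k6
      obtain ⟨s, s1, s2, s3, -⟩ := h6 x a b a a
      obtain ⟨t, t1, t2, t3, t4, -⟩ := h6 x a b s a
      obtain ⟨s', s1', s2', s3', -⟩ := h6 x c d c c
      obtain ⟨t', t1', t2', t3', t4', -⟩ := h6 x c d s' c
      obtain ⟨h, e1, e2, -⟩ := h4 a b s t c d s' t' k1 k2 s1 t1 k3 k4 s1' t1' k5 s2.symm t2.symm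
        s3.symm t3.symm t4.symm k6 s2'.symm t2'.symm s3'.symm t3'.symm t4'.symm
      exact ⟨h, e1, e2⟩
    have : Nontrivial ↥(G ⊓ MulAction.stabilizer (Equiv.Perm X) x) := by
      obtain ⟨s, s1, -⟩ := h6 x x x x x
      obtain ⟨t, t1, t2, -⟩ := h6 x s x x x
      obtain ⟨h, e, -⟩ := h2 s t t s s1 t1 t1 s1 t2.symm t2
      refine ⟨h, 1, ?_⟩
      rintro rfl
      exact t2 (by simpa using e.symm)
    obtain ⟨N, hN, hN1, hN2⟩ := aux_exists_abelian 4 (hsolv x)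
    refine aux_no_abelian x (fun h => h.2.2) h6 ?_ h2 N hN1 hN2
    intro a b c d d' k1 k2 k3 k4 k5 l1 l2 l3 l4 l5 l6 m1 m2 m3
    exact h4 a b c d a b c d' k1 k2 k3 k4 k1 k2 k3 k5 l1 l2 l3 l4 l5 l6 l1 l2 m1 l4 m2 m3
  push Not at key
  obtain ⟨a, b, c, d, e, hall⟩ := key
  obtain ⟨p, hp⟩ := hX
  have hsurj : Function.Surjective ![a, b, c, d, e] := by
    intro y
    by_contra! hh
    exact hh 4 (hall y (hh 0).symm (hh 1).symm (hh 2).symm (hh 3).symm).symm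
  have hfin : Finite X := Finite.of_surjective _ hsurj
  have hcard : Nat.card X = 5 := by
    have l1 := Nat.card_le_card_of_surjective _ hsurj
    have l2 := Nat.card_le_card_of_injective _ hp
    simp only [Nat.card_eq_fintype_card, Fintype.card_fin] at l1 l2
    omega
  refine ⟨?_, hfin, hcard⟩
  have hps : Function.Surjective p :=
    ((Nat.bijective_iff_injective_and_card p).2 ⟨hp, by simp [hcard]⟩).2
  rw [eq_top_iff]
  intro s _
  obtain ⟨g, hg, h⟩ := h5 p (fun i => s (p i)) hp (s.injective.comp hp)
  have : g = s := by
    ext y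
    obtain ⟨i, rfl⟩ := hps y
    exact h i
  exact this ▸ hg
end
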